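/- arXiv:2310.06267 — 2 statements merged into one kernel-verified Lean document; each statement's English description precedes it below -/
import Mathlib

section
/- For any g, g' ∈ Γ, if the join of g and g' with respect to the weak order exists, then it belongs to Γ. -/
/-!
Let `(W,S)` be a Coxeter system, given by a Coxeter matrix `M : CoxeterMatrix B`
and `cs : CoxeterSystem M W`; the set `S` of simple reflections is the range of
`cs.simple`, and `S` is finite since `B` is finite.
-/

variable {B W : Type*} [Group W] {M : CoxeterMatrix B}

/-- The weak order on `W`: `p ⪯ g` iff `ℓ(p) + ℓ(p⁻¹g) = ℓ(g)`. -/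
def WeakLe (cs : CoxeterSystem M W) (p g : W) : Prop :=
  cs.length p + cs.length (p⁻¹ * g) = cs.length g

/-- The cone type of `g`: `T(g) = {h ∈ W : ℓ(gh) = ℓ(g) + ℓ(h)}`. -/
def ConeType (cs : CoxeterSystem M W) (g : W) : Set W :=
  {h : W | cs.length (g * h) = cs.length g + cs.length h}

/-- `j` is the join of `g` and `g'` with respect to the weak order. -/
def IsJoin (cs : CoxeterSystem M W) (g g' j : W) : Prop :=
  WeakLe cs g j ∧ WeakLe cs g' j ∧
    ∀ f : W, WeakLe cs g f → WeakLe cs g' f → WeakLe cs j f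

open CoxeterSystem in
/-- The generator action used for the exchange property. -/
noncomputable def exPerm (cs : CoxeterSystem M W) (i : B) : Equiv.Perm (W × ZMod 2) := by
  classical
  exact Function.Involutive.toPerm
    (fun p => (cs.simple i * p.1 * cs.simple i, p.2 + if p.1 = cs.simple i then 1 else 0))
    (by
      rintro ⟨x, e⟩
      have h1 : cs.simple i * (cs.simple i * x * cs.simple i) * cs.simple i = x := by
        simp [mul_assoc]
      have h2 : (cs.simple i * x * cs.simple i = cs.simple i) ↔ x = cs.simple i := by
        constructor
        · intro h
          rw [h] at h1
          simpa using h1.symm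
        · rintro rfl; simp
      simp only [h1, h2, Prod.mk.injEq, true_and]
      rw [add_assoc, CharTwo.add_self_eq_zero, add_zero])

open Classical in
theorem exPerm_apply (cs : CoxeterSystem M W) (i : B) (x : W) (e : ZMod 2) :
    exPerm cs i (x, e) =
      (cs.simple i * x * cs.simple i, e + if x = cs.simple i then 1 else 0) := by
  rfl

open Classical in
theorem exPerm_pow (cs : CoxeterSystem M W) (i j : B) (n : ℕ) (x : W) (e : ZMod 2) :
    ((exPerm cs i * exPerm cs j) ^ n) (x, e) =
      ((cs.simple i * cs.simple j) ^ n * x * ((cs.simple i * cs.simple j) ^ n)⁻¹,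
        e + ∑ k ∈ Finset.range (2 * n),
          if x = cs.simple j * (cs.simple i * cs.simple j) ^ k then (1 : ZMod 2) else 0) := by
  induction n with
  | zero => simp
  | succ n ih =>
    rw [pow_succ', Equiv.Perm.mul_apply, ih, Equiv.Perm.mul_apply, exPerm_apply, exPerm_apply]
    set r := cs.simple i * cs.simple j with hr
    have hri : r⁻¹ = cs.simple j * cs.simple i := by simp [hr]
    have hc : ∀ k : ℕ, cs.simple j * r ^ k = (r ^ k)⁻¹ * cs.simple j := by
      intro k
      induction k with
      | zero => simp
      | succ k ihk =>
        rw [pow_succ, ← mul_assoc, ihk, ← pow_succ, pow_succ', mul_inv_rev, hri, hr]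
        simp only [mul_assoc]
    have h1 : (r ^ n * x * (r ^ n)⁻¹ = cs.simple j) ↔ x = cs.simple j * r ^ (2 * n) := by
      rw [two_mul, pow_add, ← mul_assoc, hc, mul_inv_eq_iff_eq_mul, mul_assoc,
        ← eq_inv_mul_iff_mul_eq]
    have h2 : (cs.simple j * (r ^ n * x * (r ^ n)⁻¹) * cs.simple j = cs.simple i) ↔
        x = cs.simple j * r ^ (2 * n + 1) := by
      have e1 : (cs.simple j * (r ^ n * x * (r ^ n)⁻¹) * cs.simple j = cs.simple i) ↔
          r ^ n * x * (r ^ n)⁻¹ = cs.simple j * r := by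
        constructor
        · intro h
          have h' := congrArg (fun q => cs.simple j * q * cs.simple j) h
          simp only [mul_assoc, cs.simple_mul_simple_cancel_left, cs.simple_mul_simple_self,
            mul_one] at h'
          rw [mul_assoc]; exact h'
        · intro h
          rw [h, hr]; simp [mul_assoc]
      have e2 : cs.simple j * r ^ (2 * n + 1) = (r ^ n)⁻¹ * (cs.simple j * r) * r ^ n := by
        rw [← mul_assoc, ← hc, show 2 * n + 1 = n + (1 + n) by ring, pow_add, pow_add, pow_one]
        simp only [mul_assoc]
      rw [e1, e2, mul_inv_eq_iff_eq_mul, ← eq_inv_mul_iff_mul_eq]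
      simp only [mul_assoc]
    have h3 : 2 * (n + 1) = 2 * n + 1 + 1 := by ring
    rw [h3, Finset.sum_range_succ, Finset.sum_range_succ]
    simp only [h1, h2]
    refine Prod.ext ?_ ?_
    · simp [pow_succ', hr, mul_assoc]
    · simp [add_assoc]

theorem exPerm_lift (cs : CoxeterSystem M W) : M.IsLiftable (exPerm cs) := by
  classical
  intro i j
  ext1 ⟨x, e⟩
  rw [exPerm_pow, cs.simple_mul_simple_pow, two_mul, Finset.sum_range_add]
  simp only [pow_add, cs.simple_mul_simple_pow, one_mul]
  rw [CharTwo.add_self_eq_zero]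
  simp

noncomputable def exHom (cs : CoxeterSystem M W) : W →* Equiv.Perm (W × ZMod 2) :=
  cs.lift ⟨exPerm cs, exPerm_lift cs⟩

theorem exHom_simple (cs : CoxeterSystem M W) (i : B) :
    exHom cs (cs.simple i) = exPerm cs i := by
  simp [exHom]

noncomputable def exEta (cs : CoxeterSystem M W) (w x : W) : ZMod 2 := (exHom cs w (x, 0)).2

theorem exHom_apply (cs : CoxeterSystem M W) (w x : W) :
    ∀ e : ZMod 2, exHom cs w (x, e) = (w * x * w⁻¹, e + exEta cs w x) := by
  induction w using cs.simple_induction_left generalizing x with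
  | one => intro e; simp [exEta]
  | mul_simple_left w i ih =>
    intro e
    have : ∀ e, exHom cs (cs.simple i * w) (x, e) = exPerm cs i (exHom cs w (x, e)) := by
      intro e; rw [map_mul, exHom_simple]; rfl
    unfold exEta
    rw [this, this, ih, ih, exPerm_apply, exPerm_apply]
    simp [mul_assoc, add_assoc]

theorem exEta_mul (cs : CoxeterSystem M W) (v w x : W) :
    exEta cs (v * w) x = exEta cs w x + exEta cs v (w * x * w⁻¹) := by
  conv_lhs => unfold exEta
  rw [map_mul, Equiv.Perm.mul_apply, exHom_apply, exHom_apply]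
  simp

open Classical in
theorem exEta_simple (cs : CoxeterSystem M W) (i : B) (x : W) :
    exEta cs (cs.simple i) x = if x = cs.simple i then 1 else 0 := by
  simp [exEta, exHom_simple, exPerm_apply]

theorem exEta_mem (cs : CoxeterSystem M W) (ω : List B) (x : W)
    (h : exEta cs (cs.wordProd ω) x ≠ 0) : x ∈ cs.rightInvSeq ω := by
  classical
  induction ω with
  | nil => simp [exEta] at h
  | cons i ω ih =>
    rw [cs.wordProd_cons, exEta_mul, exEta_simple] at h
    simp only [CoxeterSystem.rightInvSeq, List.mem_cons]
    by_cases h2 : exEta cs (cs.wordProd ω) x = 0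
    · left
      rw [h2, zero_add] at h
      have h3 : cs.wordProd ω * x * (cs.wordProd ω)⁻¹ = cs.simple i := by
        by_contra h4
        simp [h4] at h
      rw [← h3]; group
    · right; exact ih h2

theorem exEta_lt (cs : CoxeterSystem M W) (w x : W)
    (h : exEta cs w x ≠ 0) : cs.length (w * x) < cs.length w := by
  obtain ⟨ω, hω, rfl⟩ := cs.exists_isReduced w
  exact (cs.isRightInversion_of_mem_rightInvSeq hω (exEta_mem cs ω x h)).2

theorem exEta_ne (cs : CoxeterSystem M W) (w : W) (i : B)
    (h : cs.length (w * cs.simple i) < cs.length w) : exEta cs w (cs.simple i) ≠ 0 := by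
  intro h0
  have h1 : exEta cs (w * cs.simple i) (cs.simple i) ≠ 0 := by
    rw [exEta_mul, exEta_simple]
    simp [h0]
  have := exEta_lt cs _ _ h1
  rw [mul_assoc, cs.simple_mul_simple_self, mul_one] at this
  omega

/-- Exchange, right version. -/
theorem ex_right (cs : CoxeterSystem M W) (v w : W) (i : B)
    (h : cs.length (v * w * cs.simple i) < cs.length (v * w)) :
    cs.length (w * cs.simple i) < cs.length w ∨
      cs.length (v * (w * cs.simple i * w⁻¹)) < cs.length v := by
  have h1 := exEta_ne cs _ _ h
  rw [exEta_mul] at h1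
  by_cases h2 : exEta cs w (cs.simple i) = 0
  · right
    rw [h2, zero_add] at h1
    exact exEta_lt cs _ _ h1
  · left; exact exEta_lt cs _ _ h2

/-- Exchange, left version. -/
theorem ex_left (cs : CoxeterSystem M W) (v w : W) (i : B)
    (h : cs.length (cs.simple i * (v * w)) < cs.length (v * w)) :
    cs.length (cs.simple i * v) < cs.length v ∨
      cs.length (v⁻¹ * (cs.simple i * (v * w))) < cs.length w := by
  have h1 := ex_right cs w⁻¹ v⁻¹ i (by
    rw [← cs.length_inv, ← cs.length_inv (w⁻¹ * v⁻¹)]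
    simpa [mul_assoc] using h)
  rcases h1 with h1 | h1
  · left
    rw [← cs.length_inv, ← cs.length_inv v]
    simpa using h1
  · right
    rw [← cs.length_inv, ← cs.length_inv w]
    simpa [mul_assoc] using h1

theorem ex_del (cs : CoxeterSystem M W) (i : B) (ω : List B)
    (h : cs.length (cs.simple i * cs.wordProd ω) < cs.length (cs.wordProd ω)) :
    ∃ ω' : List B, ω'.length < ω.length ∧ (∀ k ∈ ω', k ∈ ω) ∧
      cs.wordProd ω' = cs.simple i * cs.wordProd ω := by
  induction ω using List.reverseRecOn with
  | nil => simp at h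
  | append_singleton ω k ih =>
    rw [cs.wordProd_append, cs.wordProd_singleton] at h ⊢
    rcases ex_left cs _ _ i h with h1 | h1
    · obtain ⟨ω', a, b, c⟩ := ih h1
      refine ⟨ω' ++ [k], by simpa using a, ?_, ?_⟩
      · intro l hl
        simp only [List.mem_append] at hl ⊢
        rcases hl with hl | hl
        · exact Or.inl (b l hl)
        · exact Or.inr hl
      · rw [cs.wordProd_append, cs.wordProd_singleton, c, mul_assoc]
    · rw [cs.length_simple, Nat.lt_one_iff, cs.length_eq_zero_iff, inv_mul_eq_one] at h1
      exact ⟨ω, by simp, fun l hl => by simp [hl], h1⟩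

/-- Membership in the rank two standard parabolic subgroup. -/
def InP (cs : CoxeterSystem M W) (a b : B) (z : W) : Prop :=
  ∃ ω : List B, (∀ k ∈ ω, k = a ∨ k = b) ∧ z = cs.wordProd ω

theorem InP.mul {cs : CoxeterSystem M W} {a b : B} {y z : W} (hy : InP cs a b y)
    (hz : InP cs a b z) : InP cs a b (y * z) := by
  obtain ⟨ω, h, rfl⟩ := hy
  obtain ⟨ξ, h', rfl⟩ := hz
  refine ⟨ω ++ ξ, ?_, by rw [cs.wordProd_append]⟩
  intro k hk
  rcases List.mem_append.1 hk with hk | hk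
  · exact h k hk
  · exact h' k hk

theorem InP.inv {cs : CoxeterSystem M W} {a b : B} {y : W} (hy : InP cs a b y) :
    InP cs a b y⁻¹ := by
  obtain ⟨ω, h, rfl⟩ := hy
  exact ⟨ω.reverse, fun k hk => h k (by simpa using hk), by rw [cs.wordProd_reverse]⟩

theorem InP.one (cs : CoxeterSystem M W) (a b : B) : InP cs a b 1 := ⟨[], by simp, by simp⟩

theorem InP.simple (cs : CoxeterSystem M W) {a b i : B} (hi : i = a ∨ i = b) :
    InP cs a b (cs.simple i) := ⟨[i], by simpa using hi, by simp⟩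

theorem InP.symm {cs : CoxeterSystem M W} {a b : B} {y : W} (hy : InP cs a b y) :
    InP cs b a y := by
  obtain ⟨ω, h, rfl⟩ := hy
  exact ⟨ω, fun k hk => (h k hk).symm, rfl⟩

theorem InP.reduced {cs : CoxeterSystem M W} {a b : B} {z : W} (hz : InP cs a b z) :
    ∃ ω : List B, (∀ k ∈ ω, k = a ∨ k = b) ∧ z = cs.wordProd ω ∧ cs.length z = ω.length := by
  obtain ⟨ω, h, rfl⟩ := hz
  induction ω with
  | nil => exact ⟨[], by simp, by simp, by simp⟩
  | cons i ω ih =>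
    obtain ⟨ξ, h1, h2, h3⟩ := ih (fun k hk => h k (List.mem_cons_of_mem _ hk))
    rw [cs.wordProd_cons, h2]
    rw [h2] at h3
    rcases cs.length_simple_mul (cs.wordProd ξ) i with h4 | h4
    · refine ⟨i :: ξ, ?_, by rw [cs.wordProd_cons], by simp; omega⟩
      intro k hk
      rcases List.mem_cons.1 hk with rfl | hk
      · exact h _ (by simp)
      · exact h1 k hk
    · obtain ⟨ξ', a1, a2, a3⟩ := ex_del cs i ξ (by omega)
      refine ⟨ξ', fun k hk => h1 k (a2 k hk), a3.symm, ?_⟩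
      have := cs.length_wordProd_le ξ'
      rw [a3] at this
      omega

theorem InP.desc {cs : CoxeterSystem M W} {a b : B} {z : W} (hz : InP cs a b z) (h1 : z ≠ 1) :
    cs.length (cs.simple a * z) < cs.length z ∨ cs.length (cs.simple b * z) < cs.length z := by
  obtain ⟨ω, h, rfl, hl⟩ := hz.reduced
  cases ω with
  | nil => simp at h1
  | cons i ω =>
    have h2 : cs.length (cs.simple i * cs.wordProd (i :: ω)) <
        cs.length (cs.wordProd (i :: ω)) := by
      rw [hl, cs.wordProd_cons, cs.simple_mul_simple_cancel_left]
      have := cs.length_wordProd_le ω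
      simp; omega
    rcases h i (by simp) with rfl | rfl
    · exact Or.inl h2
    · exact Or.inr h2

theorem InP.eq_simple {cs : CoxeterSystem M W} {a b : B} {z : W} (hz : InP cs a b z)
    (h1 : cs.length z = 1) : ∃ i, (i = a ∨ i = b) ∧ z = cs.simple i := by
  obtain ⟨ω, h, rfl, hl⟩ := hz.reduced
  rw [h1] at hl
  obtain ⟨i, rfl⟩ := List.length_eq_one_iff.1 hl.symm
  exact ⟨i, h i (by simp), by simp⟩

theorem InP.add {cs : CoxeterSystem M W} {a b : B} {x : W}
    (hx : ∀ z, InP cs a b z → cs.length x ≤ cs.length (z * x)) {z : W} (hz : InP cs a b z) :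
    cs.length (z * x) = cs.length z + cs.length x := by
  obtain ⟨ω, h, rfl⟩ := hz
  induction ω with
  | nil => simp
  | cons i ω ih =>
    have ih := ih (fun k hk => h k (List.mem_cons_of_mem _ hk))
    have hP : InP cs a b (cs.wordProd ω) :=
      ⟨ω, fun k hk => h k (List.mem_cons_of_mem _ hk), rfl⟩
    have hi : InP cs a b (cs.simple i) := InP.simple cs (h i (by simp))
    rw [cs.wordProd_cons, mul_assoc]
    set z := cs.wordProd ω
    rcases cs.length_simple_mul z i with h1 | h1
    · rcases cs.length_simple_mul (z * x) i with h2 | h2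
      · omega
      · rcases ex_left cs z x i (by omega) with h3 | h3
        · omega
        · have := hx _ ((hP.inv.mul hi).mul hP)
          simp only [mul_assoc] at this h3
          omega
    · have h3 := cs.length_mul_le (cs.simple i * z) x
      rw [mul_assoc] at h3
      rcases cs.length_simple_mul (z * x) i with h2 | h2 <;> omega

theorem exists_min_coset (cs : CoxeterSystem M W) (a b : B) (w : W) :
    ∃ z x, InP cs a b z ∧ w = z * x ∧
      ∀ y, InP cs a b y → cs.length (y * x) = cs.length y + cs.length x := by
  obtain ⟨z, hz, hm⟩ := WellFounded.has_min (measure fun z => cs.length (z * w)).wf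
    {z | InP cs a b z} ⟨1, InP.one cs a b⟩
  refine ⟨z⁻¹, z * w, InP.inv hz, by simp, fun y hy => InP.add ?_ hy⟩
  intro y hy
  have := hm (y * z) (hy.mul hz)
  change ¬ (cs.length (y * z * w) < cs.length (z * w)) at this
  rw [← mul_assoc]; omega

theorem top_lemma (cs : CoxeterSystem M W) (a b : B) (w : W)
    (ha : cs.length (cs.simple a * w) < cs.length w)
    (hb : cs.length (cs.simple b * w) < cs.length w) {z : W} (hz : InP cs a b z) :
    cs.length (z⁻¹ * w) + cs.length z = cs.length w := by
  obtain ⟨ω, h, rfl, hl⟩ := hz.reduced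
  clear hz
  induction ω with
  | nil => simp
  | cons i ω ih =>
    have h1 := cs.length_wordProd_le ω
    have hi : cs.length (cs.simple i * w) < cs.length w := by
      rcases h i (by simp) with rfl | rfl <;> assumption
    have h2 : cs.length (cs.simple i * cs.wordProd ω) = ω.length + 1 := by
      rw [← cs.wordProd_cons, hl]; simp
    have h3 := cs.length_simple_mul (cs.wordProd ω) i
    have ih := ih (fun k hk => h k (List.mem_cons_of_mem _ hk)) (by omega)
    rw [cs.wordProd_cons]
    set z := cs.wordProd ω
    have h5 := ex_left cs z (z⁻¹ * w) i (by simpa using hi)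
    have h6 := cs.length_mul_le (cs.simple i * z) ((cs.simple i * z)⁻¹ * w)
    simp only [mul_inv_cancel_left, mul_inv_rev, cs.inv_simple, mul_assoc,
      cs.simple_mul_simple_cancel_left] at h5 h6 ⊢
    omega

theorem WeakLe.trans {cs : CoxeterSystem M W} {p q r : W} (h1 : WeakLe cs p q)
    (h2 : WeakLe cs q r) : WeakLe cs p r := by
  unfold WeakLe at *
  have h3 := cs.length_mul_le (p⁻¹ * q) (q⁻¹ * r)
  have h4 := cs.length_mul_le p (p⁻¹ * r)
  simp only [mul_assoc, mul_inv_cancel_left] at h3 h4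
  omega

theorem WeakLe.refl (cs : CoxeterSystem M W) (p : W) : WeakLe cs p p := by
  simp [WeakLe]

theorem WeakLe.antisymm {cs : CoxeterSystem M W} {p q : W} (h1 : WeakLe cs p q)
    (h2 : WeakLe cs q p) : p = q := by
  unfold WeakLe at *
  have : cs.length (p⁻¹ * q) = 0 := by omega
  rwa [cs.length_eq_zero_iff, inv_mul_eq_one] at this

theorem mem_cone (cs : CoxeterSystem M W) (g h : W) :
    h ∈ ConeType cs g⁻¹ ↔ cs.length (g⁻¹ * h) = cs.length g + cs.length h := by
  simp [ConeType]

theorem cone_anti {cs : CoxeterSystem M W} {k g : W} (h : WeakLe cs k g) :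
    ConeType cs g⁻¹ ⊆ ConeType cs k⁻¹ := by
  intro x hx
  rw [mem_cone] at *
  unfold WeakLe at h
  have h1 := cs.length_mul_le (g⁻¹ * k) (k⁻¹ * x)
  have h2 := cs.length_mul_le k⁻¹ x
  have h3 := cs.length_inv (k⁻¹ * g)
  have h4 := cs.length_inv k
  simp only [mul_assoc, mul_inv_cancel_left, mul_inv_rev, inv_inv] at h1 h3
  omega

/-- A proper lower bound is below some coatom. -/
theorem exists_desc {cs : CoxeterSystem M W} {k j : W} (h : WeakLe cs k j) (hne : k ≠ j) :
    ∃ i, cs.length (j * cs.simple i) + 1 = cs.length j ∧ WeakLe cs k (j * cs.simple i) := by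
  have h1 : k⁻¹ * j ≠ 1 := by
    intro h; exact hne (inv_mul_eq_one.1 h)
  obtain ⟨i, hi⟩ := cs.exists_rightDescent_of_ne_one h1
  rw [cs.isRightDescent_iff] at hi
  unfold WeakLe at *
  refine ⟨i, ?_⟩
  have h2 := cs.length_mul_le k (k⁻¹ * j * cs.simple i)
  have h3 := cs.length_mul_simple j i
  simp only [mul_assoc, mul_inv_cancel_left] at *
  omega

/-- Key step: no element of the cone has only the descent `a`. -/
theorem key_K (cs : CoxeterSystem M W) (a b : B) (c : W)
    (hc : ∀ y, InP cs a b y → cs.length (y * c⁻¹) = cs.length y + cs.length c)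
    (hno : ∀ h x, h ∈ ConeType cs c⁻¹ → c⁻¹ * h = cs.simple a * x →
      (∀ y, InP cs a b y → cs.length (y * x) = cs.length y + cs.length x) → False) :
    ∀ n h, cs.length h = n → h ∈ ConeType cs c⁻¹ →
      cs.length (cs.simple a * (c⁻¹ * h)) < cs.length (c⁻¹ * h) →
      ¬ cs.length (cs.simple b * (c⁻¹ * h)) < cs.length (c⁻¹ * h) → False := by
  intro n
  induction n with
  | zero =>
    intro h hn _ h2 _
    rw [cs.length_eq_zero_iff] at hn
    subst hn
    have := hc _ (InP.simple cs (Or.inl rfl))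
    simp only [mul_one, cs.length_inv] at h2
    omega
  | succ n ih =>
    intro h hn h1 h2 h3
    have hne : h ≠ 1 := by
      rintro rfl; simp at hn
    obtain ⟨v, hv⟩ := cs.exists_rightDescent_of_ne_one hne
    rw [cs.isRightDescent_iff] at hv
    set h' := h * cs.simple v with hh'
    rw [mem_cone] at h1
    have hw : cs.length (c⁻¹ * h') + 1 = cs.length (c⁻¹ * h) := by
      have e1 := cs.length_mul_le c⁻¹ h'
      rw [cs.length_inv] at e1
      rcases cs.length_mul_simple (c⁻¹ * h) v with e | e <;>
        rw [mul_assoc, ← hh'] at e <;> omega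
    have h1' : h' ∈ ConeType cs c⁻¹ := by
      rw [mem_cone]; omega
    have hb' : ¬ cs.length (cs.simple b * (c⁻¹ * h')) < cs.length (c⁻¹ * h') := by
      intro hb
      have e1 := cs.length_simple_mul (c⁻¹ * h) b
      have e2 := cs.length_mul_le (cs.simple b * (c⁻¹ * h')) (cs.simple v)
      rw [cs.length_simple] at e2
      have e3 : cs.simple b * (c⁻¹ * h') * cs.simple v = cs.simple b * (c⁻¹ * h) := by
        simp [hh', mul_assoc]
      rw [e3] at e2
      omega
    have ha' : ¬ cs.length (cs.simple a * (c⁻¹ * h')) < cs.length (c⁻¹ * h') := by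
      intro ha
      exact ih h' (by omega) h1' ha hb'
    have e3 : c⁻¹ * h' * cs.simple v = c⁻¹ * h := by
      simp [hh', mul_assoc]
    have e4 : c⁻¹ * h = cs.simple a * (c⁻¹ * h') := by
      rcases ex_left cs (c⁻¹ * h') (cs.simple v) a (by rw [e3]; exact h2) with e | e
      · exact absurd e ha'
      · rw [cs.length_simple, Nat.lt_one_iff, cs.length_eq_zero_iff, inv_mul_eq_one, e3] at e
        rw [e]; simp
    obtain ⟨z, x, hz, hzx, hx⟩ := exists_min_coset cs a b (c⁻¹ * h')
    have hz1 : z = 1 := by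
      by_contra hz1
      rcases hz.desc hz1 with e | e
      · apply ha'
        rw [hzx, ← mul_assoc, hx _ ((InP.simple cs (Or.inl rfl)).mul hz), hx _ hz]
        omega
      · apply hb'
        rw [hzx, ← mul_assoc, hx _ ((InP.simple cs (Or.inr rfl)).mul hz), hx _ hz]
        omega
    rw [hz1, one_mul] at hzx
    refine hno h (c⁻¹ * h') (by rw [mem_cone]; exact h1) e4 ?_
    rw [hzx]; exact hx

/-- Core of the rank two argument, where `y` is the longest element. -/
theorem core (cs : CoxeterSystem M W) (a b : B) (c y : W)
    (hc : ∀ z, InP cs a b z → cs.length (z * c⁻¹) = cs.length z + cs.length c)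
    (hyP : InP cs a b y) (hyy : y⁻¹ = y)
    (hy : ∀ z, InP cs a b z → cs.length (z⁻¹ * y) + cs.length z = cs.length y)
    (hT : ConeType cs (c * (cs.simple a * y))⁻¹ = ConeType cs (c * y)⁻¹) :
    ConeType cs c⁻¹ ⊆ ConeType cs (c * (cs.simple b * y))⁻¹ := by
  have hPa : InP cs a b (cs.simple a) := InP.simple cs (Or.inl rfl)
  have hPb : InP cs a b (cs.simple b) := InP.simple cs (Or.inr rfl)
  have hcl : ∀ z, InP cs a b z → cs.length (c * z) = cs.length z + cs.length c := by
    intro z hz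
    have := hc _ hz.inv
    rw [← mul_inv_rev, cs.length_inv, cs.length_inv] at this
    exact this
  have hy' : ∀ z, InP cs a b z → cs.length (y * z) + cs.length z = cs.length y := by
    intro z hz
    have := hy z hz
    rw [← cs.length_inv (z⁻¹ * y), mul_inv_rev, inv_inv, hyy] at this
    exact this
  have hmem : ∀ v z x h, InP cs a b v → InP cs a b z → c⁻¹ * h = z * x →
      h ∈ ConeType cs c⁻¹ →
      (∀ y, InP cs a b y → cs.length (y * x) = cs.length y + cs.length x) →
      (h ∈ ConeType cs (c * v)⁻¹ ↔ cs.length (v⁻¹ * z) = cs.length v + cs.length z) := by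
    intro v z x h hv hz hzx hh hx
    rw [mem_cone] at hh ⊢
    rw [mul_inv_rev, mul_assoc, hzx, ← mul_assoc, hx _ (hv.inv.mul hz), hcl _ hv]
    rw [hzx, hx _ hz] at hh
    omega
  have hK := key_K cs a b c hc (by
    intro h x hh e hx
    have h1 := (hmem (cs.simple a * y) _ x h (hPa.mul hyP) hPa e hh hx).2 (by
      have q := hy _ hPa
      rw [cs.inv_simple] at q
      rw [mul_inv_rev, hyy, cs.inv_simple, mul_assoc, cs.simple_mul_simple_self, mul_one]
      omega)
    rw [hT] at h1
    have h2 := (hmem y _ x h hyP hPa e hh hx).1 h1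
    have := hy' _ hPa
    rw [hyy] at h2
    have := cs.length_simple a
    omega)
  intro h hh
  obtain ⟨z, x, hz, hzx, hx⟩ := exists_min_coset cs a b (c⁻¹ * h)
  rw [hmem _ z x h (hPb.mul hyP) hz hzx hh hx]
  have hb1 := hy _ hPb
  have hl1 := cs.length_simple b
  rw [cs.inv_simple] at hb1
  have hd : ∀ i, (i = a ∨ i = b) → (cs.length (cs.simple i * (c⁻¹ * h)) < cs.length (c⁻¹ * h) ↔
      cs.length (cs.simple i * z) < cs.length z) := by
    intro i hi
    rw [hzx, ← mul_assoc, hx _ ((InP.simple cs hi).mul hz), hx _ hz]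
    omega
  have hzz := hy' _ (hPb.mul hz)
  rw [mul_inv_rev, hyy, cs.inv_simple, mul_assoc]
  by_cases z1 : z = 1
  · subst z1
    simp only [mul_one, cs.length_one] at *
    omega
  by_cases zb : z = cs.simple b
  · subst zb
    simp only [cs.simple_mul_simple_self, cs.length_one] at *
    omega
  exfalso
  by_cases db : cs.length (cs.simple b * z) < cs.length z
  · -- fold by the reflection
    have db' := (hd b (Or.inr rfl)).2 db
    have hh0 := hh
    rw [mem_cone] at hh0
    set h2 := c * (cs.simple b * (c⁻¹ * h)) with hh2
    have e1 : c⁻¹ * h2 = cs.simple b * (c⁻¹ * h) := by simp [hh2]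
    have e2 : cs.length h2 < cs.length h := by
      rcases ex_left cs c⁻¹ h b db' with e | e
      · have := hc _ hPb
        rw [cs.length_inv] at e
        omega
      · rwa [inv_inv] at e
    have e3 : h2 ∈ ConeType cs c⁻¹ := by
      rw [mem_cone]
      have := cs.length_mul_le c⁻¹ h2
      have := cs.length_simple_mul (c⁻¹ * h) b
      rw [cs.length_inv] at *
      rw [e1] at *
      omega
    have e4 : c⁻¹ * h2 = (cs.simple b * z) * x := by rw [e1, hzx, mul_assoc]
    have hbz := hPb.mul hz
    have hd2 : ∀ i, (i = a ∨ i = b) →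
        (cs.length (cs.simple i * (c⁻¹ * h2)) < cs.length (c⁻¹ * h2) ↔
        cs.length (cs.simple i * (cs.simple b * z)) < cs.length (cs.simple b * z)) := by
      intro i hi
      rw [e4, ← mul_assoc, hx _ ((InP.simple cs hi).mul hbz), hx _ hbz]
      omega
    have nb : ¬ cs.length (cs.simple b * (cs.simple b * z)) < cs.length (cs.simple b * z) := by
      rw [cs.simple_mul_simple_cancel_left]; omega
    have n1 : cs.simple b * z ≠ 1 := by
      intro e
      apply zb
      rw [mul_eq_one_iff_eq_inv'] at e
      simpa using e
    have da := (hbz.desc n1).resolve_right nb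
    exact hK _ h2 rfl e3 ((hd2 a (Or.inl rfl)).2 da)
      (fun e => nb ((hd2 b (Or.inr rfl)).1 e))
  · have da := (hz.desc z1).resolve_right db
    exact hK _ h rfl hh ((hd a (Or.inl rfl)).2 da) (fun e => db ((hd b (Or.inr rfl)).1 e))

theorem lemma_B (cs : CoxeterSystem M W) (j : W) (s u : B)
    (hs : cs.length (j * cs.simple s) + 1 = cs.length j)
    (hu : cs.length (j * cs.simple u) + 1 = cs.length j)
    (hne : cs.simple s ≠ cs.simple u)
    (hT : ConeType cs (j * cs.simple s)⁻¹ = ConeType cs j⁻¹) :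
    ∃ c, WeakLe cs c (j * cs.simple s) ∧ WeakLe cs c (j * cs.simple u) ∧
      ConeType cs c⁻¹ = ConeType cs (j * cs.simple u)⁻¹ := by
  obtain ⟨z, x, hz, hzx, hx⟩ := exists_min_coset cs s u j⁻¹
  obtain ⟨c, rfl⟩ : ∃ c, x = c⁻¹ := ⟨x⁻¹, by simp⟩
  rw [cs.length_inv] at hx
  have hPs : InP cs s u (cs.simple s) := InP.simple cs (Or.inl rfl)
  have hPu : InP cs s u (cs.simple u) := InP.simple cs (Or.inr rfl)
  have hdz : ∀ i, (i = s ∨ i = u) → cs.length (j * cs.simple i) + 1 = cs.length j →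
      cs.length (cs.simple i * z) + 1 = cs.length z := by
    intro i hi h
    rw [← cs.length_inv, mul_inv_rev, cs.inv_simple, ← cs.length_inv j, hzx, ← mul_assoc,
      hx _ ((InP.simple cs hi).mul hz), hx _ hz] at h
    omega
  have hzs := hdz s (Or.inl rfl) hs
  have hzu := hdz u (Or.inr rfl) hu
  have htop : ∀ y, InP cs s u y → cs.length (y⁻¹ * z) + cs.length y = cs.length z :=
    fun y hy => top_lemma cs s u z (by omega) (by omega) hy
  have hzz : z⁻¹ = z := by
    have := htop _ hz.inv
    rw [cs.length_inv, inv_inv, Nat.add_eq_right, cs.length_eq_zero_iff] at this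
    exact inv_eq_of_mul_eq_one_left this
  have hj : j = c * z := by
    rw [← inv_inv j, hzx, mul_inv_rev, inv_inv, hzz]
  have hz2 : z * z = 1 := by
    nth_rewrite 1 [← hzz]; simp
  have hconj : ∀ i, (i = s ∨ i = u) → cs.length (cs.simple i * z) + 1 = cs.length z →
      ∃ k, (k = s ∨ k = u) ∧ z * cs.simple i * z = cs.simple k := by
    intro i hi h
    have hP : InP cs s u (z * cs.simple i * z) := (hz.mul (InP.simple cs hi)).mul hz
    apply hP.eq_simple
    have h1 := htop _ hP
    have h2 : (z * cs.simple i * z)⁻¹ * z = (cs.simple i * z)⁻¹ := by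
      simp only [mul_inv_rev, cs.inv_simple, hzz, mul_assoc, hz2, mul_one]
    rw [h2, cs.length_inv] at h1
    omega
  obtain ⟨a, ha, hza⟩ := hconj s (Or.inl rfl) hzs
  obtain ⟨b, hb, hzb⟩ := hconj u (Or.inr rfl) hzu
  have hab : a ≠ b := by
    rintro rfl
    rw [← hzb] at hza
    exact hne (mul_left_cancel (mul_right_cancel hza))
  have hswap : ∀ y, InP cs a b y ↔ InP cs s u y := by
    intro y
    rcases ha with rfl | rfl <;> rcases hb with rfl | rfl
    · exact absurd rfl hab
    · rfl
    · exact ⟨InP.symm, InP.symm⟩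
    · exact absurd rfl hab
  have hjs : j * cs.simple s = c * (cs.simple a * z) := by
    rw [hj, ← hza]; simp only [mul_assoc, hz2, mul_one]
  have hju : j * cs.simple u = c * (cs.simple b * z) := by
    rw [hj, ← hzb]; simp only [mul_assoc, hz2, mul_one]
  have hle : ∀ v, InP cs s u v → WeakLe cs c (c * v) := by
    intro v hv
    have := hx _ hv.inv
    rw [← mul_inv_rev, cs.length_inv, cs.length_inv] at this
    simp only [WeakLe, inv_mul_cancel_left]
    omega
  have hleu : WeakLe cs c (j * cs.simple u) := by
    rw [hju]; exact hle _ ((InP.simple cs hb).mul hz)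
  refine ⟨c, ?_, hleu, ?_⟩
  · rw [hjs]; exact hle _ ((InP.simple cs ha).mul hz)
  · refine subset_antisymm ?_ (cone_anti hleu)
    rw [hju]
    rw [hjs, hj] at hT
    exact core cs a b c z (fun y hy => hx y ((hswap y).1 hy)) ((hswap z).2 hz) hzz
      (fun y hy => htop y ((hswap y).1 hy)) hT

theorem mono_lemma (cs : CoxeterSystem M W) : ∀ n (j k g : W), cs.length j = n →
    WeakLe cs k j → ConeType cs k⁻¹ = ConeType cs j⁻¹ → WeakLe cs g j →
    ∃ y, WeakLe cs y k ∧ WeakLe cs y g ∧ ConeType cs y⁻¹ = ConeType cs g⁻¹ := by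
  intro n
  induction n with
  | zero =>
    intro j k g hn hk hT hg
    have h1 : j = 1 := cs.length_eq_zero_iff.1 hn
    have h2 : k = 1 := cs.length_eq_zero_iff.1 (by unfold WeakLe at hk; omega)
    have h3 : g = 1 := cs.length_eq_zero_iff.1 (by unfold WeakLe at hg; omega)
    subst h1 h2 h3
    exact ⟨1, WeakLe.refl _ _, WeakLe.refl _ _, rfl⟩
  | succ n ih =>
    intro j k g hn hk hT hg
    by_cases hkj : k = j
    · subst hkj
      exact ⟨g, hg, WeakLe.refl _ _, rfl⟩
    by_cases hgj : g = j
    · subst hgj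
      exact ⟨k, WeakLe.refl _ _, hk, hT⟩
    obtain ⟨s, hs, hks⟩ := exists_desc hk hkj
    obtain ⟨u, hu, hgu⟩ := exists_desc hg hgj
    have hsj : WeakLe cs (j * cs.simple s) j := by
      simp [WeakLe, hs]
    have hT1 : ConeType cs k⁻¹ = ConeType cs (j * cs.simple s)⁻¹ :=
      subset_antisymm (hT ▸ cone_anti hsj) (cone_anti hks)
    by_cases hsu : cs.simple s = cs.simple u
    · rw [← hsu] at hgu
      exact ih (j * cs.simple s) k g (by omega) hks hT1 hgu
    · obtain ⟨c, hc1, hc2, hc3⟩ := lemma_B cs j s u hs hu hsu (hT1.symm.trans hT)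
      obtain ⟨y1, a1, a2, a3⟩ := ih (j * cs.simple u) c g (by omega) hc2 hc3 hgu
      obtain ⟨y, b1, b2, b3⟩ := ih (j * cs.simple s) k y1 (by omega) hks hT1 (a1.trans hc1)
      exact ⟨y, b1, b2.trans a2, b3.trans a3⟩

/-- For `g, g' ∈ Γ = {μ(g) : g ∈ W}`, if the join of `g` and `g'` exists,
then it belongs to `Γ`. -/
theorem join_mem_Gamma [Finite B] (cs : CoxeterSystem M W) (mu : W → W)
    (hmu : ∀ g : W, ConeType cs (mu g)⁻¹ = ConeType cs g⁻¹ ∧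
      ∀ h : W, ConeType cs h⁻¹ = ConeType cs g⁻¹ → WeakLe cs (mu g) h) :
    ∀ g ∈ Set.range mu, ∀ g' ∈ Set.range mu, ∀ j : W,
      IsJoin cs g g' j → j ∈ Set.range mu := by
  have key : ∀ g ∈ Set.range mu, ∀ j, WeakLe cs g j → WeakLe cs g (mu j) := by
    rintro _ ⟨g, rfl⟩ j hj
    obtain ⟨y, h1, h2, h3⟩ := mono_lemma cs _ j (mu j) (mu g) rfl ((hmu j).2 j rfl) (hmu j).1 hj
    exact ((hmu g).2 y (h3.trans (hmu g).1)).trans h1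
  intro g hg g' hg' j ⟨h1, h2, h3⟩
  exact ⟨j, WeakLe.antisymm ((hmu j).2 j rfl) (h3 _ (key g hg j h1) (key g' hg' j h2))⟩
end

section
/- (Bipodality) Let r, q be sharp-angled reflections, with w ∈ W such that s = w⁻¹rw ∈ S and t = w⁻¹qw ∈ S, and let g ∈ W lie in the geometric fundamental domain for ⟨r,q⟩ containing w. Assume there is a reflection u that separates g from the wall of r or separates g from the wall of q. Then for every reflection r' of the form vrv⁻¹ or vqv⁻¹ with v ∈ ⟨r,q⟩ and r' ∉ {r,q}, there is a reflection u' separating g from the wall of r'. -/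
/-!
Let `(W,S)` be a Coxeter system, given by a Coxeter matrix `M : CoxeterMatrix B`
and `cs : CoxeterSystem M W`; the set `S` of simple reflections is the range of
`cs.simple`, and `S` is finite since `B` is finite.
-/

variable {B W : Type*} [Group W] {M : CoxeterMatrix B}

/-- `f ∈ W` is adjacent to the wall of the reflection `r` if `f⁻¹rf ∈ S`. -/
def AdjWall (cs : CoxeterSystem M W) (f r : W) : Prop :=
  ∃ i : B, f⁻¹ * r * f = cs.simple i

/-- The reflection `q` separates the identity from the wall of the reflection `r`
if `ℓ(qf) < ℓ(f)` for every `f` adjacent to the wall of `r`. -/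
def SepIdWall (cs : CoxeterSystem M W) (q r : W) : Prop :=
  cs.IsReflection q ∧ ∀ f : W, AdjWall cs f r → cs.length (q * f) < cs.length f

/-- A reflection `r` is elementary if no reflection separates the identity
from the wall of `r`. -/
def IsElementary (cs : CoxeterSystem M W) (r : W) : Prop :=
  cs.IsReflection r ∧ ¬ ∃ q : W, SepIdWall cs q r

/-- One step `g → gs` (with `s ∈ S`) crossing a non-elementary wall `gsg⁻¹ ∉ ℰ`. -/
def ShiStep (cs : CoxeterSystem M W) (g h : W) : Prop :=
  ∃ i : B, h = g * cs.simple i ∧ ¬ IsElementary cs (g * cs.simple i * g⁻¹)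

/-- `g` and `h` lie in the same Shi part: there is a sequence `g = g₀, …, gₙ = h`
with `gᵢ₊₁ = gᵢsᵢ`, `sᵢ ∈ S`, and `gᵢsᵢgᵢ⁻¹ ∉ ℰ`. -/
def SameShiPart (cs : CoxeterSystem M W) : W → W → Prop :=
  Relation.ReflTransGen (ShiStep cs)

/-- A reflection `u` separates `g, h ∈ W` if exactly one of `ℓ(ug) < ℓ(g)` and
`ℓ(uh) < ℓ(h)` holds. -/
def SepPts (cs : CoxeterSystem M W) (u g h : W) : Prop :=
  Xor' (cs.length (u * g) < cs.length g) (cs.length (u * h) < cs.length h)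

/-- A reflection `u` separates `g ∈ W` from the wall of the reflection `r` if `u`
separates `g` from every `f` adjacent to the wall of `r`. -/
def SepFromWall (cs : CoxeterSystem M W) (u g r : W) : Prop :=
  ∀ f : W, AdjWall cs f r → SepPts cs u g f



namespace BP
noncomputable section
set_option linter.all false

open Real

/-- the bilinear form -/
def bf (M : CoxeterMatrix B) : (B →₀ ℝ) →ₗ[ℝ] (B →₀ ℝ) →ₗ[ℝ] ℝ :=
  Finsupp.linearCombination ℝ (fun i => Finsupp.linearCombination ℝ
    (fun j => -cos (π / (M i j : ℝ))))

/-- simple root -/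
def al (i : B) : B →₀ ℝ := Finsupp.single i 1

lemma bf_al (i j : B) : bf M (al i) (al j) = -cos (π / (M i j : ℝ)) := by
  simp [bf, al]

lemma bf_al_self (i : B) : bf M (al i) (al i) = 1 := by
  rw [bf_al, M.diagonal]; simp

lemma bf_symm (v w : B →₀ ℝ) : bf M v w = bf M w v := by
  have : bf M = (bf M).flip := by
    ext i j
    have := bf_al (M := M) i j
    have h2 := bf_al (M := M) j i
    rw [M.symmetric j i] at h2
    simp only [al] at this h2
    simp [this, h2]
  conv_lhs => rw [this]
  rfl

/-- simple reflection operator -/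
def sg (M : CoxeterMatrix B) (i : B) : Module.End ℝ (B →₀ ℝ) :=
  LinearMap.id - (2:ℝ) • (bf M (al i)).smulRight (al i)

lemma sg_apply (i : B) (v : B →₀ ℝ) : sg M i v = v - (2 * bf M (al i) v) • al i := by
  simp [sg, smul_smul]

lemma sg_sg (i : B) (v : B →₀ ℝ) : sg M i (sg M i v) = v := by
  simp only [sg_apply, map_sub, map_smul, bf_al_self, smul_eq_mul]
  module

lemma bf_sg (i : B) (v w : B →₀ ℝ) : bf M (sg M i v) (sg M i w) = bf M v w := by
  simp only [sg_apply, map_sub, map_smul, bf_al_self, smul_eq_mul, LinearMap.sub_apply,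
    LinearMap.smul_apply]
  rw [bf_symm v (al i)]
  ring

lemma sg_gam (i j : B) (x : ℝ) (th : ℝ) (h : bf M (al i) (al j) = - cos th) :
    sg M i (sin x • al i + sin (x + th) • al j) =
      -(sin (-x - 2 * th) • al i + sin (- x - th) • al j) := by
  simp only [sg_apply, map_add, map_smul, bf_al_self, smul_eq_mul, h]
  have e1 : sin (-x - 2 * th) = - sin (x + 2 * th) := by rw [← sin_neg]; ring_nf
  have e2 : sin (-x - th) = - sin (x + th) := by rw [← sin_neg]; ring_nf
  have e3 : sin (x + 2 * th) = 2 * sin (x+th) * cos th - sin x := by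
    rw [show x + 2 * th = (x + th) + th by ring, sin_add (x+th) th]
    have : sin x = sin (x+th) * cos th - cos (x+th) * sin th := by
      rw [← sin_sub]; ring_nf
    linarith
  rw [e1, e2, e3]
  module

lemma sg_gam' (i j : B) (x : ℝ) (th : ℝ) (h : bf M (al i) (al j) = - cos th) :
    sg M j (sin x • al i + sin (x + th) • al j) =
      -(sin (-x) • al i + sin (- x + th) • al j) := by
  have h' : bf M (al j) (al i) = - cos th := by rw [bf_symm, h]
  have := sg_gam j i (-x-th) th h'
  have k := congrArg (sg M j) this
  rw [sg_sg, map_neg] at k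
  have e1 : sin (-(-x-th) - 2 * th) = - sin (-x+th) := by rw [← sin_neg]; ring_nf
  have e2 : sin (-(-x-th) - th) = sin (x) := by ring_nf
  have e4 : sin (-x-th) = - sin (x+th) := by rw [← sin_neg]; ring_nf
  have e3 : sin (-x-th+th) = - sin x := by rw [← sin_neg]; ring_nf
  rw [e3, e4] at this
  rw [show sin x • al i + sin (x+th) • al j = -(-sin (x+th) • al j + -sin x • al i) by module,
    map_neg, this, e1, e2, sin_neg]
  module

lemma sg_rel (i j : B) : (sg M i * sg M j) ^ M i j = 1 := by
  by_cases hij : i = j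
  · subst hij
    rw [M.diagonal, pow_one]
    ext1 v; ext1
    simp [sg_sg]
  rcases Nat.eq_zero_or_pos (M i j) with h0 | h0
  · rw [h0, pow_zero]
  have h1 := M.off_diagonal i j hij
  obtain ⟨m, hm⟩ : ∃ m : ℕ, M i j = m := ⟨_, rfl⟩
  have h2 : 2 ≤ m := by
    have : M i j ≠ 1 := h1
    omega
  set th : ℝ := π / m with hth
  have hb : bf M (al i) (al j) = - cos th := by rw [bf_al, hm]
  have hm0 : (2:ℝ) ≤ m := by exact_mod_cast h2
  have hth0 : 0 < th := by positivity
  have hthpi : th < π := by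
    rw [hth, div_lt_iff₀ (by linarith)]; nlinarith [pi_pos]
  have hsin : sin th ≠ 0 := (sin_pos_of_pos_of_lt_pi hth0 hthpi).ne'
  set T := sg M i * sg M j with hT
  have hT1 : ∀ x, T (sin x • al i + sin (x + th) • al j) =
      sin (x - 2 * th) • al i + sin (x - 2 * th + th) • al j := by
    intro x
    rw [hT, Module.End.mul_apply, sg_gam' i j x th hb, map_neg, sg_gam i j (-x) th hb]
    rw [neg_neg]; ring_nf
  have hTk : ∀ k : ℕ, ∀ x, (T ^ k) (sin x • al i + sin (x + th) • al j) =
      sin (x - 2 * k * th) • al i + sin (x - 2 * k * th + th) • al j := by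
    intro k
    induction k with
    | zero => intro x; simp
    | succ k ih =>
      intro x
      rw [pow_succ, Module.End.mul_apply, hT1, ih]
      push_cast; ring_nf
  have hTm : ∀ x, (T ^ m) (sin x • al i + sin (x + th) • al j) =
      sin x • al i + sin (x + th) • al j := by
    intro x
    rw [hTk]
    have : 2 * (m:ℝ) * th = 2 * π := by rw [hth]; field_simp
    rw [this, sin_sub_two_pi, show x - 2 * π + th = (x + th) - 2 * π by ring, sin_sub_two_pi]
  have haj : (T ^ m) (al j) = al j := by
    have := hTm 0
    simp only [sin_zero, zero_smul, zero_add, map_smul] at this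
    exact smul_right_injective _ hsin this
  have hai : (T ^ m) (al i) = al i := by
    have := hTm (-th)
    simp only [neg_add_cancel, sin_zero, zero_smul, add_zero, map_smul] at this
    exact smul_right_injective _ (by simpa using hsin) this
  have hfix : ∀ v, bf M (al i) v = 0 → bf M (al j) v = 0 → (T ^ m) v = v := by
    intro v hv1 hv2
    have : T v = v := by
      rw [hT, Module.End.mul_apply, sg_apply j, hv2, mul_zero, zero_smul, sub_zero,
        sg_apply i, hv1, mul_zero, zero_smul, sub_zero]
    clear hTk hTm haj hai
    induction m with
    | zero => simp
    | succ k ih =>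
      clear ih
      have : ∀ k : ℕ, (T ^ k) v = v := by
        intro k
        induction k with
        | zero => simp
        | succ k ih => rw [pow_succ, Module.End.mul_apply, this, ih]
      exact this _
  rw [hm]
  refine LinearMap.ext fun v => ?_
  set c := cos th
  have hs2 : sin th ^ 2 = 1 - c ^ 2 := by rw [sin_sq]
  have hs2' : 1 - c^2 ≠ 0 := by rw [← hs2]; exact pow_ne_zero _ hsin
  obtain ⟨p, hp⟩ : ∃ p, bf M (al i) v = p := ⟨_, rfl⟩
  obtain ⟨q, hq⟩ : ∃ p, bf M (al j) v = p := ⟨_, rfl⟩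
  set a := (p + c * q) / (1 - c^2) with ha
  set b := (q + c * p) / (1 - c^2) with hbb
  have hb' : bf M (al j) (al i) = - c := by rw [bf_symm, hb]
  have := hfix (v - a • al i - b • al j) (by
      simp only [map_sub, map_smul, bf_al_self, hb, smul_eq_mul, hp]
      rw [ha, hbb]; field_simp; ring) (by
      simp only [map_sub, map_smul, bf_al_self, hb', smul_eq_mul, hq]
      rw [ha, hbb]; field_simp; ring)
  simp only [map_sub, map_smul, hai, haj] at this
  have h3 : (T^m) v = v := by
    have := congrArg (fun x => x + b • al j + a • al i) this
    simpa using this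
  simpa using h3

lemma sg_lift : M.IsLiftable (sg M) := sg_rel

/-- geometric representation -/
def rep (cs : CoxeterSystem M W) : W →* Module.End ℝ (B →₀ ℝ) :=
  cs.lift ⟨sg M, sg_lift⟩

lemma rep_simple (cs : CoxeterSystem M W) (i : B) (v) :
    rep cs (cs.simple i) v = v - (2 * bf M (al i) v) • al i := by
  rw [rep, cs.lift_apply_simple, sg_apply]

lemma rep_mul (cs : CoxeterSystem M W) (x y : W) (v) :
    rep cs (x * y) v = rep cs x (rep cs y v) := by
  rw [map_mul, Module.End.mul_apply]

lemma rep_one (cs : CoxeterSystem M W) (v) : rep cs 1 v = v := by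
  rw [map_one, Module.End.one_apply]

lemma rep_inv_self (cs : CoxeterSystem M W) (x : W) (v) : rep cs x⁻¹ (rep cs x v) = v := by
  rw [← rep_mul, inv_mul_cancel, rep_one]

lemma rep_self_inv (cs : CoxeterSystem M W) (x : W) (v) : rep cs x (rep cs x⁻¹ v) = v := by
  rw [← rep_mul, mul_inv_cancel, rep_one]

lemma bf_rep (cs : CoxeterSystem M W) (x : W) (v w) :
    bf M (rep cs x v) (rep cs x w) = bf M v w := by
  induction x using cs.simple_induction_left generalizing v w with
  | one => simp [rep_one]
  | mul_simple_left x i ih =>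
    rw [rep_mul, rep_mul, rep, cs.lift_apply_simple, bf_sg]
    exact ih v w

lemma rep_inj (cs : CoxeterSystem M W) (x : W) {v w} (h : rep cs x v = rep cs x w) : v = w := by
  rw [← rep_inv_self cs x v, h, rep_inv_self]

end
end BP


namespace BP
noncomputable section
set_option linter.all false

open Real

/-- positive vector -/
def Pos (v : B →₀ ℝ) : Prop := v ≠ 0 ∧ ∀ i, 0 ≤ v i

lemma Pos.add {v w : B →₀ ℝ} (hv : Pos v) (hw : ∀ i, 0 ≤ w i) : Pos (v + w) := by
  refine ⟨?_, fun i => by simpa using add_nonneg (hv.2 i) (hw i)⟩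
  intro h
  apply hv.1
  ext i
  have := DFunLike.congr_fun h i
  simp at this
  have h1 := hv.2 i
  have h2 := hw i
  simp; linarith

lemma Pos.smul {v : B →₀ ℝ} (hv : Pos v) {a : ℝ} (ha : 0 < a) : Pos (a • v) :=
  ⟨smul_ne_zero ha.ne' hv.1, fun i => by simpa using mul_nonneg ha.le (hv.2 i)⟩

lemma Pos.not_neg {v : B →₀ ℝ} (hv : Pos v) : ¬ Pos (-v) := by
  intro h
  apply hv.1
  ext i
  have h1 := hv.2 i
  have h2 := h.2 i
  simp at h2 ⊢; linarith

lemma Pos.comb {v w : B →₀ ℝ} (hv : Pos v) (hw : Pos w) {a b : ℝ} (ha : 0 ≤ a) (hb : 0 ≤ b)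
    (hab : 0 < a ∨ 0 < b) : Pos (a • v + b • w) := by
  rcases hab with h | h
  · exact (hv.smul h).add (fun i => by simpa using mul_nonneg hb (hw.2 i))
  · rw [add_comm]
    exact (hw.smul h).add (fun i => by simpa using mul_nonneg ha (hv.2 i))

lemma pos_al (i : B) : Pos (al i) := by
  constructor
  · simp [al]
  · intro j
    classical
    simp only [al, Finsupp.single_apply]; split_ifs <;> norm_num

/-- Chebyshev-like sequence -/
def ch (c : ℝ) : ℕ → ℝ
  | 0 => 0
  | 1 => 1
  | (k+2) => 2 * c * ch c (k+1) - ch c k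

lemma ch_one (k : ℕ) : ch 1 k = k := by
  induction k using Nat.twoStepInduction with
  | zero => simp [ch]
  | one => simp [ch]
  | more k h1 h2 => simp [ch, h1, h2]; ring

lemma ch_sin (th : ℝ) (k : ℕ) : ch (cos th) k * sin th = sin (k * th) := by
  induction k using Nat.twoStepInduction with
  | zero => simp [ch]
  | one => simp [ch]
  | more k h1 h2 =>
    simp only [ch, sub_mul]
    rw [h1, mul_assoc, h2]
    push_cast
    have e1 : ((k:ℝ) + 2) * th = (k+1) * th + th := by ring
    have e2 : (k:ℝ) * th = (k+1) * th - th := by ring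
    push_cast
    rw [e1, e2, sin_add, sin_sub]; push_cast; ring

lemma two_le_M {i j : B} (hij : i ≠ j) (h0 : M i j ≠ 0) : 2 ≤ M i j := by
  have : M i j ≠ 1 := M.off_diagonal i j hij
  omega

lemma th_facts {m : ℕ} (h2 : 2 ≤ m) : 0 < π / (m:ℝ) ∧ π / (m:ℝ) < π ∧ m * (π / (m:ℝ)) = π := by
  have hm0 : (2:ℝ) ≤ m := by exact_mod_cast h2
  refine ⟨by positivity, ?_, by field_simp⟩
  rw [div_lt_iff₀ (by linarith)]; nlinarith [pi_pos]

lemma ch_nonneg {i j : B} (hij : i ≠ j) (k : ℕ) (hk : M i j ≠ 0 → k ≤ M i j) :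
    0 ≤ ch (cos (π / (M i j : ℝ))) k := by
  by_cases h0 : M i j = 0
  · rw [h0]; simp [ch_one]
  · have h2 := two_le_M hij h0
    obtain ⟨h3, h4, h5⟩ := th_facts h2
    have hs := sin_pos_of_pos_of_lt_pi h3 h4
    have := ch_sin (π / (M i j : ℝ)) k
    have h6 : 0 ≤ sin (k * (π / (M i j : ℝ))) := by
      apply sin_nonneg_of_nonneg_of_le_pi (by positivity)
      rw [← h5]
      have := hk h0
      gcongr
      rw [h5]
    rw [← this] at h6
    exact nonneg_of_mul_nonneg_left h6 hs

lemma ch_pos {i j : B} (hij : i ≠ j) (k : ℕ) (hk0 : 0 < k) (hk : M i j ≠ 0 → k < M i j) :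
    0 < ch (cos (π / (M i j : ℝ))) k := by
  by_cases h0 : M i j = 0
  · rw [h0]; simp [ch_one, hk0]
  · have h2 := two_le_M hij h0
    obtain ⟨h3, h4, h5⟩ := th_facts h2
    have hs := sin_pos_of_pos_of_lt_pi h3 h4
    have := ch_sin (π / (M i j : ℝ)) k
    have hk0' : (0:ℝ) < k := by exact_mod_cast hk0
    have h6 : 0 < sin (k * (π / (M i j : ℝ))) := by
      apply sin_pos_of_pos_of_lt_pi (by positivity)
      have : (k:ℝ) < M i j := by exact_mod_cast hk h0
      calc _ < (M i j : ℝ) * (π / (M i j : ℝ)) := by gcongr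
        _ = π := h5
    rw [← this] at h6
    exact pos_of_mul_pos_left h6 hs.le

open CoxeterSystem

lemma rep_alt (cs : CoxeterSystem M W) (s t : B) (k : ℕ) :
    rep cs (cs.wordProd (alternatingWord s t k)) (al s) =
      if Even k then ch (cos (π / (M s t : ℝ))) (k+1) • al s + ch (cos (π / (M s t : ℝ))) k • al t
      else ch (cos (π / (M s t : ℝ))) k • al s + ch (cos (π / (M s t : ℝ))) (k+1) • al t := by
  have hb : bf M (al s) (al t) = -cos (π / (M s t : ℝ)) := bf_al s t
  have hb' : bf M (al t) (al s) = -cos (π / (M s t : ℝ)) := by rw [bf_symm, hb]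
  induction k with
  | zero => simp [ch, alternatingWord, rep_one]
  | succ k ih =>
    rw [alternatingWord_succ', wordProd_cons, rep_mul, ih]
    by_cases hk : Even k
    · have : ¬ Even (k+1) := by simpa [Nat.even_add_one] using hk
      simp only [hk, this, if_true, if_false, rep_simple, map_add, map_smul, hb', bf_al_self, ch, smul_eq_mul]
      module
    · have : Even (k+1) := by simpa [Nat.even_add_one] using hk
      simp only [hk, this, if_true, if_false, rep_simple, map_add, map_smul, hb, bf_al_self, ch, smul_eq_mul]
      module

theorem pos_of_length (cs : CoxeterSystem M W) (n : ℕ) : ∀ (w : W) (s : B), cs.length w = n →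
    cs.length w < cs.length (w * cs.simple s) → Pos (rep cs w (al s)) := by
  induction n using Nat.strong_induction_on with
  | _ n ih =>
  intro w s hn hws
  by_cases hw : w = 1
  · subst hw; rw [rep_one]; exact pos_al s
  obtain ⟨t, ht⟩ := cs.exists_rightDescent_of_ne_one hw
  have hst : s ≠ t := by
    rintro rfl
    unfold IsRightDescent at ht; omega
  classical
  let Pk : ℕ → Prop := fun k => ∃ v, w = v * cs.wordProd (alternatingWord s t k) ∧
    cs.length w = cs.length v + k
  have h1 : Pk 1 := by
    refine ⟨w * cs.simple t, ?_, ?_⟩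
    · simp [alternatingWord]
    · have := cs.isRightDescent_iff.1 ht; omega
  have hn1 : 1 ≤ cs.length w := by
    rcases h1 with ⟨v, hv, hv2⟩; omega
  set k := Nat.findGreatest Pk (cs.length w) with hk
  have hPk : Pk k := Nat.findGreatest_spec (P := Pk) hn1 h1
  have hk1 : 1 ≤ k := Nat.le_findGreatest hn1 h1
  have hmax : ¬ Pk (k+1) := by
    intro h
    have : k + 1 ≤ cs.length w := by rcases h with ⟨v, _, h⟩; omega
    have := Nat.le_findGreatest this h
    omega
  clear_value k
  obtain ⟨v, hv, hvl⟩ := hPk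
  have hx : cs.length v < cs.length (v * cs.simple (if Even k then t else s)) := by
    by_contra hcon
    rcases cs.length_mul_simple v (if Even k then t else s) with h | h
    · omega
    apply hmax
    refine ⟨v * cs.simple (if Even k then t else s), ?_, ?_⟩
    · rw [alternatingWord_succ', wordProd_cons, hv]
      simp [mul_assoc]
    · omega
  have hy : cs.length v < cs.length (v * cs.simple (if Even k then s else t)) := by
    by_contra hcon
    obtain ⟨j, rfl⟩ : ∃ j, k = j + 1 := ⟨k-1, by omega⟩
    have hif : (if Even (j+1) then s else t) = (if Even j then t else s) := by
      by_cases h : Even j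
      · simp [Nat.even_add_one, h]
      · simp [Nat.even_add_one, h]
    rw [hif] at hcon
    rw [alternatingWord_succ', wordProd_cons, ← mul_assoc] at hv
    have h1 := cs.length_mul_le (v * cs.simple (if Even j then t else s)) (cs.wordProd (alternatingWord s t j))
    rw [← hv] at h1
    have h2 := cs.length_wordProd_le (alternatingWord s t j)
    rw [length_alternatingWord] at h2
    rcases cs.length_mul_simple v (if Even j then t else s) with h | h <;> omega
  have hs : cs.length v < cs.length (v * cs.simple s) := by
    split_ifs at hx hy <;> assumption
  have ht' : cs.length v < cs.length (v * cs.simple t) := by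
    split_ifs at hx hy <;> assumption
  have ps := ih (cs.length v) (by omega) v s rfl hs
  have pt := ih (cs.length v) (by omega) v t rfl ht'
  have hbd : M s t ≠ 0 → k + 1 ≤ M s t := by
    intro hM
    by_contra hcon
    have hM' : M t s ≠ 0 := by rw [M.symmetric]; exact hM
    apply cs.not_isReduced_alternatingWord t s hM' (m := k+1) (by rw [M.symmetric t s]; omega)
    have e : w * cs.simple s = v * cs.wordProd (alternatingWord t s (k+1)) := by
      rw [alternatingWord_succ, wordProd_concat, hv, mul_assoc]
    have h1 := cs.length_mul_le v (cs.wordProd (alternatingWord t s (k+1)))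
    have h2 := cs.length_wordProd_le (alternatingWord t s (k+1))
    rw [← e] at h1
    unfold CoxeterSystem.IsReduced
    rw [length_alternatingWord] at h2 ⊢
    omega
  have c1 := ch_nonneg hst (k+1) hbd
  have c2 := ch_pos hst k hk1 (fun h => by have := hbd h; omega)
  rw [hv, rep_mul, rep_alt]
  split_ifs
  · rw [map_add, map_smul, map_smul]
    exact ps.comb pt c1 c2.le (Or.inr c2)
  · rw [map_add, map_smul, map_smul]
    exact ps.comb pt c2.le c1 (Or.inl c2)

end
end BP


namespace BP
noncomputable section
set_option linter.all false

open Real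

/-- root -/
def Root (cs : CoxeterSystem M W) (v : B →₀ ℝ) : Prop := ∃ w i, v = rep cs w (al i)

variable {cs : CoxeterSystem M W}

lemma root_al (i : B) : Root cs (al i) := ⟨1, i, by rw [rep_one]⟩

lemma Root.rep {v} (h : Root cs v) (x : W) : Root cs (rep cs x v) := by
  obtain ⟨w, i, rfl⟩ := h
  exact ⟨x * w, i, by rw [rep_mul]⟩

lemma rep_simple_self (i : B) : rep cs (cs.simple i) (al i) = - al i := by
  rw [rep_simple, bf_al_self]; module

lemma Root.neg {v} (h : Root cs v) : Root cs (-v) := by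
  obtain ⟨w, i, rfl⟩ := h
  exact ⟨w * cs.simple i, i, by rw [rep_mul, rep_simple_self, map_neg]⟩

lemma Root.norm {v} (h : Root cs v) : bf M v v = 1 := by
  obtain ⟨w, i, rfl⟩ := h
  rw [bf_rep, bf_al_self]

lemma pos_of_lt {w : W} {s : B} (h : cs.length w < cs.length (w * cs.simple s)) :
    Pos (rep cs w (al s)) := pos_of_length cs _ w s rfl h

lemma neg_of_lt {w : W} {s : B} (h : cs.length (w * cs.simple s) < cs.length w) :
    Pos (-(rep cs w (al s))) := by
  have : Pos (rep cs (w * cs.simple s) (al s)) := by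
    apply pos_of_lt; simpa using h
  rwa [rep_mul, rep_simple_self, map_neg] at this

lemma Root.pos_or {v} (h : Root cs v) : Pos v ∨ Pos (-v) := by
  obtain ⟨w, i, rfl⟩ := h
  rcases lt_or_gt_of_ne (cs.length_mul_simple_ne w i) with h | h
  · exact Or.inr (neg_of_lt h)
  · exact Or.inl (pos_of_lt h)

lemma Root.not_pos {v} (h : Root cs v) : ¬ Pos v ↔ Pos (-v) :=
  ⟨fun h' => h.pos_or.resolve_left h', fun h' h2 => h2.not_neg h'⟩

lemma Root.not_neg {v} (h : Root cs v) : ¬ Pos (-v) ↔ Pos v :=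
  ⟨fun h' => h.pos_or.resolve_right h', fun h' => h'.not_neg⟩

lemma lt_of_pos {w : W} {s : B} (h : Pos (rep cs w (al s))) :
    cs.length w < cs.length (w * cs.simple s) := by
  rcases lt_or_gt_of_ne (cs.length_mul_simple_ne w s) with h' | h'
  · exact absurd (neg_of_lt h') h.not_neg
  · exact h'

lemma faithful1 {x : W} (h : ∀ v, rep cs x v = v) : x = 1 := by
  by_contra hx
  obtain ⟨t, ht⟩ := cs.exists_rightDescent_of_ne_one hx
  have := neg_of_lt ht
  rw [h] at this
  exact (pos_al t).not_neg this

lemma faithful {x y : W} (h : ∀ v, rep cs x v = rep cs y v) : x = y := by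
  have : y⁻¹ * x = 1 := faithful1 (cs := cs) (fun v => by rw [rep_mul, h, rep_inv_self])
  exact (inv_mul_eq_one.1 this).symm

lemma eq_al {v} (h : Root cs v) (hp : Pos v) (i : B) (h0 : ∀ j, j ≠ i → v j = 0) : v = al i := by
  classical
  have h1 : v = v i • al i := by
    ext j
    by_cases hj : j = i
    · subst hj; simp [al]
    · rw [h0 j hj]; simp [al, Finsupp.single_apply, Ne.symm hj]
  have h2 := h.norm
  rw [h1] at h2
  simp only [map_smul, LinearMap.smul_apply, bf_al_self, smul_eq_mul] at h2
  have h3 := hp.2 i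
  have : v i = 1 := by nlinarith
  rw [h1, this, one_smul]

lemma simple_perm {v} (h : Root cs v) (hp : Pos v) (i : B)
    (hn : Pos (-(rep cs (cs.simple i) v))) : v = al i := by
  classical
  have h0 : ∀ j, j ≠ i → v j = 0 := by
    intro j hj
    have h1 := hp.2 j
    have h2 := hn.2 j
    rw [rep_simple] at h2
    simp [al, Finsupp.single_apply, hj.symm] at h2
    linarith
  exact eq_al h hp i h0

/-- inversion set -/
def Inv (cs : CoxeterSystem M W) (x : W) : Set (B →₀ ℝ) :=
  {v | Root cs v ∧ Pos v ∧ Pos (-(rep cs x v))}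

lemma inv_finite (x : W) : (Inv cs x).Finite := by
  induction x using cs.simple_induction_left with
  | one =>
    convert Set.finite_empty
    ext v
    simp only [Inv, Set.mem_setOf_eq, rep_one, Set.mem_empty_iff_false, iff_false]
    rintro ⟨_, h1, h2⟩
    exact h1.not_neg h2
  | mul_simple_left x i ih =>
    apply (ih.union (Set.finite_singleton (rep cs x⁻¹ (al i)))).subset
    rintro v ⟨h1, h2, h3⟩
    rw [rep_mul] at h3
    rcases (h1.rep x).pos_or with h | h
    · right
      have := simple_perm (h1.rep x) h i h3
      rw [Set.mem_singleton_iff, ← this, rep_inv_self]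
    · exact Or.inl ⟨h1, h2, h⟩

/-- `t` is the reflection in the root `v` -/
def RefOf (cs : CoxeterSystem M W) (t : W) (v : B →₀ ℝ) : Prop :=
  cs.IsReflection t ∧ Root cs v ∧ ∀ x, rep cs t x = x - (2 * bf M v x) • v

lemma refOf_simple (i : B) : RefOf cs (cs.simple i) (al i) :=
  ⟨cs.isReflection_simple i, root_al i, rep_simple cs i⟩

lemma RefOf.conj {t v} (h : RefOf cs t v) (x : W) : RefOf cs (x * t * x⁻¹) (rep cs x v) := by
  refine ⟨h.1.conj x, h.2.1.rep x, fun y => ?_⟩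
  rw [rep_mul, rep_mul, h.2.2, map_sub, map_smul, rep_self_inv]
  congr 3
  rw [← bf_rep cs x, rep_self_inv]

lemma Root.exists_ref {v} (h : Root cs v) : ∃ t, RefOf cs t v := by
  obtain ⟨w, i, rfl⟩ := h
  exact ⟨_, (refOf_simple i).conj w⟩

lemma exists_root {t} (h : cs.IsReflection t) : ∃ v, RefOf cs t v := by
  obtain ⟨w, i, rfl⟩ := h
  exact ⟨_, (refOf_simple i).conj w⟩

lemma RefOf.neg {t v} (h : RefOf cs t v) : RefOf cs t (-v) := by
  refine ⟨h.1, h.2.1.neg, fun x => ?_⟩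
  rw [h.2.2, map_neg, LinearMap.neg_apply]; module

lemma RefOf.self {t v} (h : RefOf cs t v) : rep cs t v = - v := by
  rw [h.2.2, h.2.1.norm]; module

lemma RefOf.unique {t t' v} (h : RefOf cs t v) (h' : RefOf cs t' v) : t = t' :=
  faithful (cs := cs) (fun x => by rw [h.2.2, h'.2.2])

lemma RefOf.root_unique {t v v'} (h : RefOf cs t v) (h' : RefOf cs t v') : v = v' ∨ v = - v' := by
  have h1 := h.self
  rw [h'.2.2] at h1
  have h2 : v = (bf M v' v) • v' := by
    have : (2:ℝ) • v = (2:ℝ) • ((bf M v' v) • v') := by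
      rw [smul_smul]
      have := congrArg (fun z => z + v + (2 * bf M v' v) • v') h1
      rw [two_smul]
      rw [sub_add_eq_add_sub, sub_add_cancel] at this
      rw [this]; simp
    exact smul_right_injective _ two_ne_zero this
  have h3 := h.2.1.norm
  set a := bf M v' v
  rw [h2] at h3
  simp only [map_smul, LinearMap.smul_apply, h'.2.1.norm, smul_eq_mul] at h3
  have : (a - 1) * (a + 1) = 0 := by linarith
  rcases mul_eq_zero.1 this with h | h
  · left; rw [h2, show a = 1 by linarith, one_smul]
  · right; rw [h2, show a = -1 by linarith]; simp

lemma ref_lt (n : ℕ) : ∀ (g t : W) (v), cs.length g = n → RefOf cs t v → Pos v →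
    Pos (-(rep cs g⁻¹ v)) → cs.length (t * g) < cs.length g := by
  induction n with
  | zero =>
    intro g t v hg _ hp hn
    rw [cs.length_eq_zero_iff.1 hg, inv_one, rep_one] at hn
    exact absurd hn hp.not_neg
  | succ n ih =>
    intro g t v hg ht hp hn
    have hg1 : g ≠ 1 := by
      rintro rfl; simp at hg
    obtain ⟨i, hi⟩ := cs.exists_leftDescent_of_ne_one hg1
    have hi' := cs.isLeftDescent_iff.1 hi
    set g' := cs.simple i * g with hg'
    have hgg : g = cs.simple i * g' := by simp [hg']
    rw [hgg, mul_inv_rev, rep_mul, cs.inv_simple] at hn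
    rcases ((ht.2.1).rep (cs.simple i)).pos_or with h | h
    · have := ih g' (cs.simple i * t * (cs.simple i)⁻¹) _ (by omega) (ht.conj _) h hn
      have e : t * g = cs.simple i * ((cs.simple i * t * (cs.simple i)⁻¹) * g') := by
        rw [hgg]; simp [mul_assoc]
      rw [e]
      have := cs.length_mul_le (cs.simple i) ((cs.simple i * t * (cs.simple i)⁻¹) * g')
      rw [cs.length_simple] at this
      omega
    · have hv := simple_perm ht.2.1 hp i h
      subst hv
      rw [ht.unique (refOf_simple i)]
      exact hi

lemma ref_lt_iff {g t v} (ht : RefOf cs t v) (hp : Pos v) :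
    cs.length (t * g) < cs.length g ↔ Pos (-(rep cs g⁻¹ v)) := by
  constructor
  · intro h
    rw [← (ht.2.1.rep _).not_pos]
    intro h2
    have : cs.length (t * (t * g)) < cs.length (t * g) := by
      apply ref_lt _ _ _ v rfl ht hp
      rw [mul_inv_rev, rep_mul, ht.1.inv, ht.self, map_neg, neg_neg]
      exact h2
    rw [← mul_assoc, ht.1.mul_self, one_mul] at this
    omega
  · exact ref_lt _ g t v rfl ht hp

lemma sepPts_iff {u g f v} (hu : RefOf cs u v) :
    SepPts cs u g f ↔ (Pos (rep cs g⁻¹ v) ↔ Pos (-(rep cs f⁻¹ v))) := by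
  wlog hp : Pos v generalizing v
  · have := this hu.neg (hu.2.1.not_pos.1 hp)
    rw [this, map_neg, map_neg, neg_neg, ← (hu.2.1.rep f⁻¹).not_pos, ← (hu.2.1.rep g⁻¹).not_pos]
    tauto
  unfold SepPts
  rw [ref_lt_iff hu hp, ref_lt_iff hu hp]
  unfold Xor'
  rw [xor_def, ← (hu.2.1.rep g⁻¹).not_pos]
  tauto

lemma adj_iff {f r γ} (hr : RefOf cs r γ) :
    AdjWall cs f r ↔ ∃ i, rep cs f⁻¹ γ = al i ∨ rep cs f⁻¹ γ = - al i := by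
  have h1 := hr.conj f⁻¹
  rw [inv_inv] at h1
  unfold AdjWall
  refine exists_congr fun i => ?_
  constructor
  · intro h
    rw [h] at h1
    exact h1.root_unique (refOf_simple i)
  · rintro (h | h)
    · rw [h] at h1
      exact h1.unique (refOf_simple i)
    · rw [h] at h1
      exact h1.unique (refOf_simple i).neg

/-- root version of separation -/
def SepR (cs : CoxeterSystem M W) (h : W) (η γ : B →₀ ℝ) : Prop :=
  ∀ f : W, (∃ i, rep cs f γ = al i ∨ rep cs f γ = - al i) →
    (Pos (rep cs h η) ↔ Pos (-(rep cs f η)))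

lemma sepFromWall_iff {u g r w η γ} (hu : RefOf cs u (rep cs w η)) (hr : RefOf cs r (rep cs w γ)) :
    SepFromWall cs u g r ↔ SepR cs (g⁻¹ * w) η γ := by
  unfold SepFromWall SepR
  constructor
  · intro h f hf
    have h1 := h (w * f⁻¹) ((adj_iff hr).2 (by simpa [← rep_mul] using hf))
    rw [sepPts_iff hu, ← rep_mul, ← rep_mul] at h1
    simpa using h1
  · intro h f hf
    rw [adj_iff hr] at hf
    rw [sepPts_iff hu, ← rep_mul, ← rep_mul]
    apply h
    simpa [rep_mul] using hf

end
end BP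


namespace BP
noncomputable section
set_option linter.all false

open Real
variable {cs : CoxeterSystem M W}

/-- height -/
def ht : (B →₀ ℝ) →ₗ[ℝ] ℝ := Finsupp.linearCombination ℝ (fun _ => (1:ℝ))

lemma Pos.ht_pos {v : B →₀ ℝ} (h : Pos v) : 0 < ht v := by
  unfold ht
  rw [Finsupp.linearCombination_apply, Finsupp.sum]
  apply Finset.sum_pos
  · intro i hi
    have := h.2 i
    have h2 : v i ≠ 0 := by simpa using hi
    simp only [smul_eq_mul, mul_one]
    exact lt_of_le_of_ne this h2.symm
  · rw [Finsupp.support_nonempty_iff]; exact h.1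

lemma exists_ip {v w : B →₀ ℝ} (h : ∀ i, 0 ≤ v i) (h2 : 0 < bf M v w) :
    ∃ i, 0 < bf M (al i) w := by
  by_contra hcon
  push Not at hcon
  have e : bf M v w = v.sum (fun i a => a * bf M (al i) w) := by
    have e1 : (bf M).flip w = Finsupp.linearCombination ℝ (fun i => bf M (al i) w) := by
      ext i; simp [al]
    have e2 := LinearMap.congr_fun e1 v
    rw [Finsupp.linearCombination_apply] at e2
    simpa using e2
  rw [e, Finsupp.sum] at h2
  have := Finset.sum_nonpos (s := v.support) (f := fun i => v i * bf M (al i) w)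
    (fun i _ => mul_nonpos_of_nonneg_of_nonpos (h i) (hcon i))
  linarith

lemma bad1 {h : W} {s i : B} {μ} (h1 : rep cs h μ = - al i) (hρ : Pos (rep cs h (al s)))
    (hc : 0 < bf M (al i) (rep cs h (al s))) (hne : rep cs h (al s) ≠ al i)
    (h2 : Pos (-(rep cs h (rep cs (cs.simple s) μ)))) : False := by
  classical
  apply hne
  apply eq_al ((root_al s).rep h) hρ
  intro j hj
  rw [rep_simple, map_sub, map_smul, h1, ← bf_rep cs h, h1] at h2
  have h3 := h2.2 j
  have h4 := hρ.2 j
  rw [map_neg, bf_symm] at h3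
  simp [al, Finsupp.single_apply, hj.symm] at h3
  simp only [al] at *
  nlinarith

lemma sub1 (η) (hη : Root cs η) (s : B) (n : ℕ) : ∀ h : W,
    cs.length (h * cs.simple s * h⁻¹) = n → Pos (rep cs h (al s)) →
    Pos (-(rep cs h η)) → Pos (-(rep cs h (rep cs (cs.simple s) η))) →
    ∃ f i, (rep cs f (al s) = al i ∨ rep cs f (al s) = - al i) ∧ Pos (-(rep cs f η)) := by
  induction n using Nat.strong_induction_on with
  | _ n ih =>
  intro h hn hp h1 h2
  have hroot := (root_al (cs := cs) s).rep h
  obtain ⟨i, hi⟩ := exists_ip (M := M) hp.2 (w := rep cs h (al s)) (by rw [hroot.norm]; norm_num)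
  by_cases hne : rep cs h (al s) = al i
  · exact ⟨h, i, Or.inl hne, h1⟩
  have hpos : Pos (rep cs (cs.simple i) (rep cs h (al s))) := by
    rw [← (hroot.rep _).not_neg]
    intro h; exact hne (simple_perm hroot hp i h)
  have key : ∀ μ, Root cs μ → Pos (-(rep cs h μ)) → Pos (-(rep cs h (rep cs (cs.simple s) μ))) →
      Pos (-(rep cs (cs.simple i) (rep cs h μ))) := by
    intro μ hμ m1 m2
    rw [← ((hμ.rep h).rep _).not_pos]
    intro m3
    have := simple_perm (hμ.rep h).neg m1 i (by rwa [map_neg, neg_neg])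
    exact bad1 (by rw [← this, neg_neg]) hp hi hne m2
  have k1 := key η hη h1 h2
  have k2 := key _ (hη.rep _) h2 (by rw [← rep_mul cs (cs.simple s), cs.simple_mul_simple_self, rep_one]; exact h1)
  have href := (refOf_simple (cs := cs) s).conj h
  set t := h * cs.simple s * h⁻¹ with ht
  have hlen : cs.length (cs.simple i * t * cs.simple i) < n := by
    have l1 : cs.length (t * cs.simple i) < cs.length t := by
      by_contra hcon
      have := pos_of_lt (cs := cs) (w := t) (s := i) (by
        have := cs.length_mul_simple_ne t i; omega)
      rw [href.2.2, bf_symm] at this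
      apply hne
      apply eq_al hroot hp
      intro j hj
      have h3 := this.2 j
      have h4 := hp.2 j
      classical
      simp [al, Finsupp.single_apply, hj.symm] at h3
      simp only [al] at *
      nlinarith
    have l2 : cs.length (cs.simple i * (t * cs.simple i)) < cs.length (t * cs.simple i) := by
      rw [ref_lt_iff (refOf_simple i) (pos_al i), mul_inv_rev, cs.inv_simple, rep_mul, href.1.inv,
        href.2.2, map_sub, rep_simple_self, map_smul]
      have e : -(-al i - (2 * bf M (rep cs h (al s)) (al i)) • rep cs (cs.simple i) (rep cs h (al s)))
        = al i + (2 * bf M (rep cs h (al s)) (al i)) • rep cs (cs.simple i) (rep cs h (al s)) := by module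
      rw [e]
      have h5 := hpos.smul (a := 2 * bf M (rep cs h (al s)) (al i)) (by rw [bf_symm]; linarith)
      exact (pos_al i).add h5.2
    rw [← mul_assoc] at l2
    omega
  obtain ⟨f, j, hf⟩ := ih _ hlen (cs.simple i * h) (by
    rw [ht]; simp [mul_assoc]) (by rw [rep_mul]; exact hpos) (by rw [rep_mul]; exact k1)
      (by rw [rep_mul]; exact k2)
  exact ⟨f, j, hf⟩

lemma sub2 (η) (hη : Root cs η) (s : B) (h : W)
    (h1 : Pos (-(rep cs h η))) (h2 : Pos (-(rep cs h (rep cs (cs.simple s) η)))) :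
    ∃ f i, (rep cs f (al s) = al i ∨ rep cs f (al s) = - al i) ∧ Pos (-(rep cs f η)) := by
  rcases ((root_al (cs := cs) s).rep h).pos_or with hp | hp
  · exact sub1 η hη s _ h rfl hp h1 h2
  · refine sub1 η hη s _ (h * cs.simple s) rfl ?_ ?_ ?_
    · rwa [rep_mul, rep_simple_self, map_neg]
    · rwa [rep_mul]
    · rwa [rep_mul, ← rep_mul cs (cs.simple s), cs.simple_mul_simple_self, rep_one]

lemma no_rec (y : ℕ → ℝ) (τ : ℝ) (hτ : τ < 2) (hy : ∀ k, 0 < y k)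
    (hr : ∀ k, y (k+2) = τ * y (k+1) - y k) : False := by
  have hd : ∀ k, y (k+2) - y (k+1) = (y (k+1) - y k) - (2 - τ) * y (k+1) := by
    intro k; rw [hr]; ring
  have hd' : ∀ k, y (k+2) - y (k+1) < (y (k+1) - y k) := by
    intro k
    have := mul_pos (sub_pos.2 hτ) (hy (k+1))
    linarith [hd k]
  by_cases hA : ∃ K, y (K+1) - y K < 0
  · obtain ⟨K, hK⟩ := hA
    have h1 : ∀ n, y (K+n+1) - y (K+n) ≤ y (K+1) - y K := by
      intro n
      induction n with
      | zero => simp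
      | succ n ih =>
        have := hd' (K+n)
        rw [show K + (n+1) = K+n+1 by ring]
        linarith
    have h2 : ∀ n : ℕ, y (K+n) ≤ y K + n * (y (K+1) - y K) := by
      intro n
      induction n with
      | zero => simp
      | succ n ih =>
        have := h1 n
        rw [show K + (n+1) = K+n+1 by ring]
        push_cast
        linarith
    obtain ⟨n, hn⟩ := exists_nat_gt (y K / (y K - y (K+1)))
    rw [div_lt_iff₀ (by linarith)] at hn
    have := h2 n
    have := hy (K+n)
    linarith
  · push Not at hA
    have h0 : ∀ k, y 0 ≤ y k := by
      intro k
      induction k with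
      | zero => simp
      | succ k ih => linarith [hA k]
    have h1 : ∀ k : ℕ, y (k+1) - y k ≤ y 1 - y 0 - k * ((2 - τ) * y 0) := by
      intro k
      induction k with
      | zero => simp
      | succ k ih =>
        have := hd k
        have := mul_le_mul_of_nonneg_left (h0 (k+1)) (sub_pos.2 hτ).le
        push_cast
        rw [show k+1+1 = k+2 by ring]
        linarith
    have hpos := mul_pos (sub_pos.2 hτ) (hy 0)
    obtain ⟨n, hn⟩ := exists_nat_gt ((y 1 - y 0) / ((2 - τ) * y 0))
    rw [div_lt_iff₀ hpos] at hn
    have := h1 n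
    have := hA n
    linarith

lemma sep_imp_aux {η h} {s : B} (hη : Root cs η) (hp : Pos η) (hα : Pos (rep cs h (al s)))
    (hs : SepR cs h η (al s)) : Pos (-(rep cs h η)) ∧ bf M η (al s) ≤ -1 := by
  have h0 : Pos (-(rep cs h η)) := by
    have := hs 1 ⟨s, Or.inl (by rw [rep_one])⟩
    rw [rep_one] at this
    rw [← (hη.rep h).not_pos, this]
    exact hp.not_neg
  refine ⟨h0, ?_⟩
  have hnb : ∀ x, Pos (-(rep cs x η)) → Pos (rep cs x (rep cs (cs.simple s) η)) := by
    intro x hx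
    rw [← ((hη.rep _).rep x).not_neg]
    intro h2
    obtain ⟨f, i, hf, hf2⟩ := sub2 η hη s x hx h2
    have := (hs f ⟨i, hf⟩).2 hf2
    exact this.not_neg h0
  obtain ⟨c, hc⟩ : ∃ c, bf M η (al s) = c := ⟨_, rfl⟩
  have hc' : bf M (al s) η = c := by rw [bf_symm, hc]
  have hsη : rep cs (cs.simple s) η = η - (2 * c) • al s := by rw [rep_simple, hc']
  obtain ⟨t, ht⟩ := hη.exists_ref
  rw [hc]
  by_contra hlt
  push Not at hlt
  rcases lt_trichotomy c 0 with hneg | hzero | hpos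
  · set ρ := cs.simple s * t with hρ
    have e1 : rep cs ρ η = - η + (2 * c) • al s := by
      rw [hρ, rep_mul, ht.self, map_neg, hsη]; module
    have e1' : rep cs ρ η = - (rep cs (cs.simple s) η) := by
      rw [e1, hsη]; module
    have e2 : rep cs ρ (al s) = (4 * c^2 - 1) • al s - (2 * c) • η := by
      rw [hρ, rep_mul, ht.2.2, hc, map_sub, map_smul, rep_simple_self, hsη]; module
    have e3 : rep cs ρ (rep cs ρ η) = (4 * c^2 - 2) • rep cs ρ η - η := by
      rw [e1, map_add, map_neg, map_smul, e1, e2]; module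
    have hrec : ∀ k : ℕ, rep cs (ρ^(k+2)) η = (4 * c^2 - 2) • rep cs (ρ^(k+1)) η - rep cs (ρ^k) η := by
      intro k
      rw [pow_add, pow_add, rep_mul, rep_mul, pow_two, rep_mul, e3, map_sub, map_smul, pow_one]
    have hneg : ∀ k : ℕ, Pos (-(rep cs (ρ^(k+1)) η)) := by
      intro k
      induction k with
      | zero =>
        rw [zero_add, pow_one, e1', neg_neg, hsη]
        rw [sub_eq_add_neg, ← neg_smul]
        exact hp.add ((pos_al s).smul (by linarith)).2
      | succ k ih =>
        have := hnb _ ih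
        rw [pow_succ ρ (k+1), rep_mul, e1', map_neg, neg_neg]
        exact this
    apply no_rec (fun k => BP.ht (-(rep cs (ρ^(k+1)) η))) (4 * c^2 - 2) (by nlinarith)
      (fun k => (hneg k).ht_pos)
    intro k
    simp only [map_neg]
    rw [show k + 2 + 1 = (k + 1) + 2 by ring, hrec (k+1), map_sub, map_smul, smul_eq_mul]
    ring
  · have := hnb t (by rw [ht.self, neg_neg]; exact hp)
    rw [hsη, hzero] at this
    simp only [mul_zero, zero_smul, sub_zero, ht.self] at this
    exact hp.not_neg this
  · have := hnb h h0
    rw [hsη, map_sub, map_smul] at this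
    have h3 := h0.add (hα.smul (a := 2 * c) (by linarith)).2
    apply this.not_neg
    convert h3 using 1
    module

lemma sep_imp {η h} {s : B} (hη : Root cs η) (hα : Pos (rep cs h (al s)))
    (hs : SepR cs h η (al s)) : ∃ η, Root cs η ∧ Pos η ∧ Pos (-(rep cs h η)) ∧ bf M η (al s) ≤ -1 := by
  rcases hη.pos_or with hp | hp
  · exact ⟨η, hη, hp, sep_imp_aux hη hp hα hs⟩
  · refine ⟨-η, hη.neg, hp, sep_imp_aux hη.neg hp hα ?_⟩
    intro f hf
    have := hs f hf
    rw [map_neg, map_neg, neg_neg, ← (hη.rep f).not_neg, ← (hη.rep h).not_pos]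
    tauto

lemma both_neg_aux {δ γ} (hδ : Root cs δ) (hγ : Root cs γ) (hb : bf M δ γ ≤ -1)
    (h1 : Pos δ) (h2 : Pos γ) (x : W) (h3 : Pos (-(rep cs x δ))) (h4 : Pos (-(rep cs x γ))) :
    False := by
  obtain ⟨c, hc⟩ : ∃ c, bf M δ γ = -c := ⟨- bf M δ γ, by ring⟩
  have hc1 : 1 ≤ c := by linarith
  have hc' : bf M γ δ = -c := by rw [bf_symm, hc]
  obtain ⟨t, ht⟩ := hδ.exists_ref
  obtain ⟨r, hr⟩ := hγ.exists_ref
  set ρ := r * t with hρ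
  have e1 : rep cs ρ γ = (4 * c^2 - 1) • γ + (2 * c) • δ := by
    rw [hρ, rep_mul, ht.2.2, hc, map_sub, map_smul, hr.self, hr.2.2 δ, hc']; module
  have e2 : rep cs ρ δ = - δ - (2 * c) • γ := by
    rw [hρ, rep_mul, ht.self, map_neg, hr.2.2 δ, hc']; module
  have hstep : ∀ k : ℕ, ∃ p q : ℝ, 0 ≤ q ∧ q < p ∧ rep cs (ρ^k) γ = p • γ + q • δ := by
    intro k
    induction k with
    | zero => exact ⟨1, 0, le_rfl, by norm_num, by simp⟩
    | succ k ih =>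
      obtain ⟨p, q, hq, hpq, e⟩ := ih
      refine ⟨(4*c^2-1)*p - 2*c*q, 2*c*p - q, by nlinarith, ?_, ?_⟩
      · nlinarith [mul_nonneg (sub_nonneg.2 hc1) (by linarith : 0 ≤ p), mul_nonneg (mul_nonneg (sub_nonneg.2 hc1) (by linarith : 0 ≤ c)) (by linarith : 0 ≤ p), mul_nonneg (sub_nonneg.2 hc1) (sub_nonneg.2 hpq.le)]
      · rw [pow_succ', rep_mul, e, map_add, map_smul, map_smul, e1, e2]; module
  have hmono : StrictMono (fun k : ℕ => BP.ht (rep cs (ρ^k) γ)) := by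
    apply strictMono_nat_of_lt_succ
    intro k
    obtain ⟨p, q, hq, hpq, e⟩ := hstep k
    have e' : rep cs (ρ^(k+1)) γ = ((4*c^2-1)*p - 2*c*q) • γ + (2*c*p - q) • δ := by
      rw [pow_succ', rep_mul, e, map_add, map_smul, map_smul, e1, e2]; module
    rw [e, e']
    simp only [map_add, map_smul, smul_eq_mul]
    have f1 := h1.ht_pos
    have f2 := h2.ht_pos
    have g1 : p ≤ (4*c^2-1)*p - 2*c*q := by
      nlinarith [mul_nonneg (sub_nonneg.2 hc1) (by linarith : 0 ≤ p), mul_nonneg (mul_nonneg (sub_nonneg.2 hc1) (by linarith : 0 ≤ c)) (by linarith : 0 ≤ p), mul_nonneg (by linarith : 0 ≤ c) (sub_nonneg.2 hpq.le)]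
    have g2 : q < 2*c*p - q := by nlinarith
    have := mul_le_mul_of_nonneg_right g1 f2.le
    have := mul_lt_mul_of_pos_right g2 f1
    linarith
  have hmem : ∀ k : ℕ, rep cs (ρ^k) γ ∈ Inv cs x := by
    intro k
    obtain ⟨p, q, hq, hpq, e⟩ := hstep k
    refine ⟨hγ.rep _, ?_, ?_⟩
    · rw [e]; exact h2.comb h1 (by linarith) hq (Or.inl (by linarith))
    · rw [e, map_add, map_smul, map_smul, neg_add, ← smul_neg, ← smul_neg]
      exact h4.comb h3 (by linarith) hq (Or.inl (by linarith))
  have hinj : Function.Injective (fun k : ℕ => rep cs (ρ^k) γ) := by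
    intro a b hab
    exact hmono.injective (congrArg BP.ht hab)
  exact Set.infinite_of_injective_forall_mem hinj hmem (inv_finite x)

lemma both_neg {δ γ} (hδ : Root cs δ) (hγ : Root cs γ) (hb : bf M δ γ ≤ -1) (x0 : W)
    (h1 : Pos (rep cs x0 δ)) (h2 : Pos (rep cs x0 γ)) (x : W) (h3 : Pos (-(rep cs x δ)))
    (h4 : Pos (-(rep cs x γ))) : False := by
  apply both_neg_aux (hδ.rep x0) (hγ.rep x0) (by rwa [bf_rep]) h1 h2 (x * x0⁻¹)
  · rwa [rep_mul, rep_inv_self]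
  · rwa [rep_mul, rep_inv_self]

lemma sepR_of {δ γ h} (hδ : Root cs δ) (hγ : Root cs γ) (hb : bf M δ γ ≤ -1) (x0 : W)
    (h1 : Pos (rep cs x0 δ)) (h2 : Pos (rep cs x0 γ)) (hh : Pos (-(rep cs h δ))) :
    SepR cs h δ γ := by
  intro f ⟨i, hf⟩
  have hn : ¬ Pos (rep cs h δ) := fun h => h.not_neg hh
  refine iff_of_false hn ?_
  intro h3
  rcases hf with hf | hf
  · rcases ((hδ.rep f).rep (cs.simple i)).pos_or with h | h
    · have := simple_perm (hδ.rep f).neg h3 i (by rwa [map_neg, neg_neg])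
      rw [← hf, ← map_neg] at this
      have := rep_inj cs f this
      rw [← this, map_neg] at h2
      exact h1.not_neg h2
    · refine both_neg hδ hγ hb x0 h1 h2 (cs.simple i * f) ?_ ?_
      · rwa [rep_mul]
      · rw [rep_mul, hf, rep_simple_self, neg_neg]; exact pos_al i
  · exact both_neg hδ hγ hb x0 h1 h2 f h3 (by rw [hf, neg_neg]; exact pos_al i)

end
end BP


namespace BP
noncomputable section
set_option linter.all false

open Real
variable {cs : CoxeterSystem M W}

/-- in the span of three vectors -/
def InS (s t : B) (ζ v : B →₀ ℝ) : Prop := ∃ x y w : ℝ, v = x • al s + y • al t + w • ζ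

lemma plane_pos {s t : B} (hst : s ≠ t) {h : W} (hα : Pos (rep cs h (al s)))
    (hβ : Pos (rep cs h (al t))) {x y : ℝ} (hp : Pos (x • al s + y • al t)) :
    Pos (rep cs h (x • al s + y • al t)) := by
  classical
  have h1 := hp.2 s
  have h2 := hp.2 t
  simp [al, Finsupp.single_apply, hst, hst.symm] at h1 h2
  rw [map_add, map_smul, map_smul]
  apply hα.comb hβ h1 h2
  by_contra hcon
  push Not at hcon
  apply hp.1
  rw [le_antisymm hcon.1 h1, le_antisymm hcon.2 h2]; simp

lemma choose_zeta (E : Set (B →₀ ℝ)) (n : ℕ) : ∀ (h : W) (η : B →₀ ℝ), cs.length h = n →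
    η ∈ E → Root cs η → Pos η → Pos (-(rep cs h η)) →
    ∃ x1 ζ, ζ ∈ E ∧ Root cs ζ ∧ Pos ζ ∧ Pos (-(rep cs h ζ)) ∧ Pos (-(rep cs x1 ζ)) ∧
      ∀ ρ ∈ E, Root cs ρ → Pos ρ → Pos (-(rep cs x1 ρ)) → ρ = ζ := by
  induction n with
  | zero =>
    intro h η hl _ _ hp hn
    rw [cs.length_eq_zero_iff.1 hl, rep_one] at hn
    exact absurd hn hp.not_neg
  | succ n ih =>
    intro h η hl hE hη hp hn
    have h1 : h ≠ 1 := by rintro rfl; simp at hl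
    obtain ⟨i, hi⟩ := cs.exists_leftDescent_of_ne_one h1
    have hi' := cs.isLeftDescent_iff.1 hi
    set h' := cs.simple i * h with hh'
    have hhh : h = cs.simple i * h' := by simp [hh']
    by_cases hex : ∃ ρ ∈ E, Root cs ρ ∧ Pos ρ ∧ Pos (-(rep cs h' ρ))
    · obtain ⟨ρ, hρE, hρ, hρp, hρn⟩ := hex
      obtain ⟨x1, ζ, a1, a2, a3, a4, a5, a6⟩ := ih h' ρ (by omega) hρE hρ hρp hρn
      refine ⟨x1, ζ, a1, a2, a3, ?_, a5, a6⟩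
      rw [← (a2.rep h).not_pos, hhh, rep_mul]
      intro hcon
      have := simple_perm (a2.rep h').neg a4 i (by rwa [map_neg, neg_neg])
      have h2 : cs.length h' < cs.length (cs.simple i * h') := by
        rw [← hhh]; omega
      have h3 : ¬ cs.length (cs.simple i * h') < cs.length h' := by omega
      rw [ref_lt_iff (refOf_simple i) (pos_al i), ← this, map_neg, rep_inv_self, neg_neg] at h3
      exact h3 a3
    · push Not at hex
      have huniq : ∀ ρ ∈ E, Root cs ρ → Pos ρ → Pos (-(rep cs h ρ)) → ρ = rep cs h'⁻¹ (al i) := by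
        intro ρ hρE hρ hρp hρn
        have h2 := (hρ.rep h').not_neg.1 (hex ρ hρE hρ hρp)
        rw [hhh, rep_mul] at hρn
        rw [← simple_perm (hρ.rep h') h2 i hρn, rep_inv_self]
      refine ⟨h, η, hE, hη, hp, hn, hn, ?_⟩
      intro ρ hρE hρ hρp hρn
      rw [huniq ρ hρE hρ hρp hρn, ← huniq η hE hη hp hn]

/-- context for the finite case -/
structure Ctx (cs : CoxeterSystem M W) (s t : B) (h x1 : W) (ζ : B →₀ ℝ) : Prop where
  hst : s ≠ t
  root : Root cs ζ
  pos : Pos ζ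
  hneg : Pos (-(rep cs h ζ))
  hα : Pos (rep cs h (al s))
  hβ : Pos (rep cs h (al t))
  x1neg : Pos (-(rep cs x1 ζ))
  uniq : ∀ ρ, InS s t ζ ρ → Root cs ρ → Pos ρ → Pos (-(rep cs x1 ρ)) → ρ = ζ

variable {s t : B} {h x1 : W} {ζ : B →₀ ℝ}

lemma InS.swap {v} (hv : InS s t ζ v) : InS t s ζ v := by
  obtain ⟨x, y, w, rfl⟩ := hv
  exact ⟨y, x, w, by module⟩

lemma Ctx.swap (H : Ctx cs s t h x1 ζ) : Ctx cs t s h x1 ζ :=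
  ⟨H.hst.symm, H.root, H.pos, H.hneg, H.hβ, H.hα, H.x1neg, fun ρ h1 => H.uniq ρ h1.swap⟩

lemma Ctx.exj (H : Ctx cs s t h x1 ζ) : ∃ j, j ≠ s ∧ j ≠ t ∧ 0 < ζ j := by
  classical
  by_contra hcon
  push Not at hcon
  have e : ζ = ζ s • al s + ζ t • al t := by
    ext j
    by_cases h1 : j = s
    · subst h1; simp [al, Finsupp.single_apply, H.hst.symm]
    by_cases h2 : j = t
    · subst h2; simp [al, Finsupp.single_apply, H.hst]
    have := le_antisymm (hcon j h1 h2) (H.pos.2 j)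
    rw [this]; simp [al, Finsupp.single_apply, Ne.symm h1, Ne.symm h2]
  have h1 := H.pos
  have h2 := H.hneg
  rw [e] at h1 h2
  exact (plane_pos H.hst H.hα H.hβ h1).not_neg h2

lemma coordj {j : B} (h1 : j ≠ s) (h2 : j ≠ t) (x y w : ℝ) :
    (x • al s + y • al t + w • ζ) j = w * ζ j := by
  classical
  simp [al, Finsupp.single_apply, h1.symm, h2.symm]

lemma Ctx.coef_nonneg (H : Ctx cs s t h x1 ζ) {x y w : ℝ} (hp : Pos (x • al s + y • al t + w • ζ)) :
    0 ≤ w := by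
  obtain ⟨j, h1, h2, h3⟩ := H.exj
  have := hp.2 j
  rw [coordj h1 h2] at this
  exact nonneg_of_mul_nonneg_left this h3

lemma Ctx.pos_of_coef (H : Ctx cs s t h x1 ζ) {x y w : ℝ} {ρ} (hρ : Root cs ρ)
    (e : ρ = x • al s + y • al t + w • ζ) (hw : 0 < w) : Pos ρ := by
  obtain ⟨j, h1, h2, h3⟩ := H.exj
  rw [← hρ.not_neg]
  intro hn
  have := hn.2 j
  rw [e, Finsupp.neg_apply, coordj h1 h2] at this
  have := mul_pos hw h3
  linarith

lemma Ctx.coef_eq (H : Ctx cs s t h x1 ζ) {x y w : ℝ} (e : x • al s + y • al t + w • ζ = ζ) : w = 1 := by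
  obtain ⟨j, h1, h2, h3⟩ := H.exj
  have := DFunLike.congr_fun e j
  rw [coordj h1 h2] at this
  exact mul_right_cancel₀ h3.ne' (by rw [this, one_mul])

lemma Ctx.ne_s (H : Ctx cs s t h x1 ζ) : al s ≠ ζ := by
  intro e
  have := H.hα
  rw [e] at this
  exact this.not_neg H.hneg

lemma Ctx.ne_t (H : Ctx cs s t h x1 ζ) : al t ≠ ζ := H.swap.ne_s

lemma inS_s : InS s t ζ (al s) := ⟨1, 0, 0, by simp⟩
lemma inS_t : InS s t ζ (al t) := ⟨0, 1, 0, by simp⟩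
lemma inS_z : InS s t ζ ζ := ⟨0, 0, 1, by simp⟩

lemma InS.comb {v w} (hv : InS s t ζ v) (hw : InS s t ζ w) (a b : ℝ) : InS s t ζ (a • v + b • w) := by
  obtain ⟨x, y, z, rfl⟩ := hv
  obtain ⟨x', y', z', rfl⟩ := hw
  exact ⟨a * x + b * x', a * y + b * y', a * z + b * z', by module⟩

lemma InS.refl_s {v} (hv : InS s t ζ v) : InS s t ζ (rep cs (cs.simple s) v) := by
  rw [rep_simple, sub_eq_add_neg, ← neg_smul]
  simpa using hv.comb inS_s 1 (-(2 * bf M (al s) v))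

lemma InS.refl_t {v} (hv : InS s t ζ v) : InS s t ζ (rep cs (cs.simple t) v) := hv.swap.refl_s.swap

lemma InS.refl_z {v z} (hz : RefOf cs z ζ) (hv : InS s t ζ v) : InS s t ζ (rep cs z v) := by
  rw [hz.2.2, sub_eq_add_neg, ← neg_smul]
  simpa using hv.comb inS_z 1 (-(2 * bf M ζ v))

/-- indecomposability -/
lemma Ctx.dec (H : Ctx cs s t h x1 ζ) {ρ ρ'} (h1 : InS s t ζ ρ) (h2 : Root cs ρ) (h3 : Pos ρ)
    (h1' : InS s t ζ ρ') (h2' : Root cs ρ') (h3' : Pos ρ') {a b : ℝ} (ha : 0 < a) (hb : 0 < b)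
    (e : a • ζ = ρ + b • ρ') (hne : ρ' ≠ ζ) : ρ = ζ := by
  by_contra hcon
  have p1 : Pos (rep cs x1 ρ) := (h2.rep x1).not_neg.1 (fun hh => hcon (H.uniq ρ h1 h2 h3 hh))
  have p2 : Pos (rep cs x1 ρ') := (h2'.rep x1).not_neg.1 (fun hh => hne (H.uniq ρ' h1' h2' h3' hh))
  have p3 := H.x1neg.smul ha
  rw [← map_neg, ← map_smul, smul_neg, e, map_neg, map_add, map_smul] at p3
  exact (p1.add (p2.smul hb).2).not_neg p3

lemma perm_s {ρ} (h2 : Root cs ρ) (h3 : Pos ρ) (hne : ρ ≠ al s) : Pos (rep cs (cs.simple s) ρ) := by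
  rw [← (h2.rep _).not_neg]
  exact fun h => hne (simple_perm h2 h3 s h)

lemma Ctx.perm_z (H : Ctx cs s t h x1 ζ) {z ρ} (hz : RefOf cs z ζ) (h1 : InS s t ζ ρ)
    (h2 : Root cs ρ) (h3 : Pos ρ) (hne : ρ ≠ ζ) : Pos (rep cs z ρ) := by
  rw [← (h2.rep _).not_neg]
  intro hn
  by_cases hd : 0 < bf M ζ ρ
  · have h1' : InS s t ζ (-(rep cs z ρ)) := by
      have := (h1.refl_z hz).comb inS_z (-1) 0
      simpa using this
    have := H.dec h1' (h2.rep z).neg hn h1 h2 h3 (a := 2 * bf M ζ ρ) (b := 1) (by linarith) one_pos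
      (by rw [hz.2.2]; module) hne
    apply hne
    have h5 := hz.self
    rw [← this, map_neg, neg_neg, ← rep_mul, hz.1.mul_self, rep_one] at h5
    rw [← this, ← h5, neg_neg]
  · rw [hz.2.2] at hn
    have : Pos (ρ + (-(2 * bf M ζ ρ)) • ζ) := h3.add (fun i => by
      simp only [Finsupp.smul_apply, smul_eq_mul]
      exact mul_nonneg (by linarith) (H.pos.2 i))
    apply this.not_neg
    convert hn using 1
    module

lemma Ctx.e_nonneg (H : Ctx cs s t h x1 ζ) : bf M ζ (al s) ≤ 0 := by
  by_contra hcon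
  push Not at hcon
  have hp := perm_s H.root H.pos H.ne_s.symm
  have := H.dec (inS_z.refl_s (cs := cs)) (H.root.rep _) hp inS_s (root_al s) (pos_al s) (a := 1)
    (b := 2 * bf M ζ (al s)) one_pos (by linarith) (by rw [rep_simple, bf_symm (al s)]; module) H.ne_s
  rw [rep_simple, bf_symm] at this
  have h2 : (2 * bf M ζ (al s)) • al s = 0 := by simpa using this
  rw [smul_eq_zero] at h2
  rcases h2 with h2 | h2
  · linarith
  · exact (pos_al s).1 h2

lemma Ctx.e_half (H : Ctx cs s t h x1 ζ) {e : ℝ} (he : bf M ζ (al s) = -e) (hpos : 0 < e) : 1 / 2 ≤ e := by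
  by_contra hcon
  push Not at hcon
  obtain ⟨z, hz⟩ := H.root.exists_ref
  have he' : bf M (al s) ζ = -e := by rw [bf_symm, he]
  have e1 : rep cs (cs.simple s) (rep cs z (al s)) = (4*e^2-1) • al s + (0:ℝ) • al t + (2*e) • ζ := by
    rw [hz.2.2, he, map_sub, map_smul, rep_simple_self, rep_simple, he']; module
  have hr : Root cs (rep cs (cs.simple s) (rep cs z (al s))) := ((root_al s).rep _).rep _
  have hp := H.pos_of_coef hr e1 (by linarith)
  have := H.dec ⟨_, _, _, e1⟩ hr hp inS_s (root_al s) (pos_al s) (a := 2*e) (b := 1-4*e^2) (by linarith)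
    (by nlinarith) (by rw [e1]; module) H.ne_s
  rw [e1] at this
  have := H.coef_eq this
  linarith

lemma Ctx.e_sqrt (H : Ctx cs s t h x1 ζ) {e : ℝ} (he : bf M ζ (al s) = -e) (hpos : 1 / 2 < e) : 2 ≤ 4 * e ^ 2 := by
  by_contra hcon
  push Not at hcon
  obtain ⟨z, hz⟩ := H.root.exists_ref
  have he' : bf M (al s) ζ = -e := by rw [bf_symm, he]
  have e1 : rep cs (cs.simple s) (rep cs z (rep cs (cs.simple s) ζ)) = (2*e*(4*e^2-2)) • al s + (0:ℝ) • al t + (4*e^2-1) • ζ := by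
    rw [rep_simple cs s ζ, he', map_sub, map_smul, hz.self, hz.2.2 (al s), he]
    simp only [map_sub, map_neg, map_smul, rep_simple, he', bf_al_self]
    module
  have hr : Root cs (rep cs (cs.simple s) (rep cs z (rep cs (cs.simple s) ζ))) := ((H.root.rep _).rep _).rep _
  have hp := H.pos_of_coef hr e1 (by nlinarith)
  have := H.dec ⟨_, _, _, e1⟩ hr hp inS_s (root_al s) (pos_al s) (a := 4*e^2-1) (b := 2*e*(2-4*e^2)) (by nlinarith)
    (by apply mul_pos <;> linarith) (by rw [e1]; module) H.ne_s
  rw [e1] at this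
  have := H.coef_eq this
  nlinarith

lemma Ctx.lemD (H : Ctx cs s t h x1 ζ) {C e : ℝ} (hC : bf M (al s) (al t) = -C) (hC0 : 0 < C)
    (h0 : bf M ζ (al s) = 0) (he : bf M ζ (al t) = -e) (he0 : 0 < e) (he1 : e < 1) (x : W)
    (hxα : Pos (rep cs x (al s))) (hxβ : Pos (rep cs x (al t))) (hxz : Pos (rep cs x ζ))
    {ρ} (hρS : InS s t ζ ρ) (hρ : Root cs ρ) (hρp : Pos ρ) : Pos (rep cs x ρ) := by
  rw [← (hρ.rep _).not_neg]
  intro hρn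
  let F : Set (B →₀ ℝ) := {v | InS s t ζ v} ∩ Inv cs x
  have hF : F.Finite := (inv_finite x).inter_of_right _
  obtain ⟨v, hv, hmin⟩ := Set.exists_min_image F BP.ht hF ⟨ρ, hρS, hρ, hρp, hρn⟩
  obtain ⟨z, hz⟩ := H.root.exists_ref
  obtain ⟨hvS, hvr, hvp, hvn⟩ := hv
  have key : ∀ r μ, RefOf cs r μ → Pos μ → InS s t ζ (rep cs r v) → Pos (rep cs r v) →
      Pos (rep cs x μ) → bf M μ v ≤ 0 := by
    intro r μ hr hμ h1 h2 h3
    by_contra hcon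
    push Not at hcon
    have := hmin (rep cs r v) ⟨h1, hvr.rep _, h2, by
      rw [hr.2.2, map_sub, map_smul]
      convert hvn.add (h3.smul (a := 2 * bf M μ v) (by linarith)).2 using 1
      module⟩
    rw [hr.2.2, map_sub, map_smul, smul_eq_mul] at this
    have := mul_pos (by linarith : 0 < 2 * bf M μ v) hμ.ht_pos
    linarith
  have k1 := key _ _ (refOf_simple s) (pos_al s) hvS.refl_s (perm_s hvr hvp (by
    rintro rfl; exact hxα.not_neg hvn)) hxα
  have k2 := key _ _ (refOf_simple t) (pos_al t) hvS.refl_t (perm_s hvr hvp (by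
    rintro rfl; exact hxβ.not_neg hvn)) hxβ
  have k3 := key _ _ hz H.pos (hvS.refl_z hz) (H.perm_z hz hvS hvr hvp (by
    rintro rfl; exact hxz.not_neg hvn)) hxz
  obtain ⟨a, b, w, e1⟩ := hvS
  have hw := H.coef_nonneg (by rw [← e1]; exact hvp)
  have hw0 : w ≠ 0 := by
    intro hw
    rw [hw, zero_smul, add_zero] at e1
    rw [e1] at hvp hvn
    exact (plane_pos H.hst hxα hxβ hvp).not_neg hvn
  have hw : 0 < w := lt_of_le_of_ne hw hw0.symm
  have hn := hvr.norm
  have hC' : bf M (al t) (al s) = -C := by rw [bf_symm, hC]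
  have h0' : bf M (al s) ζ = 0 := by rw [bf_symm, h0]
  have he' : bf M (al t) ζ = -e := by rw [bf_symm, he]
  have hnz := H.root.norm
  rw [e1] at k1 k2 k3 hn
  simp only [map_add, map_smul, LinearMap.add_apply, LinearMap.smul_apply, smul_eq_mul, bf_al_self,
    hC, hC', h0, h0', he, he', hnz] at k1 k2 k3 hn
  have hb : 0 < b := by nlinarith
  have ha : 0 ≤ a := by
    have : 0 ≤ C * a := by nlinarith [mul_nonneg hb.le (by nlinarith : 0 ≤ 1 - e^2), mul_nonneg he0.le (by linarith : 0 ≤ e * b - w)]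
    exact nonneg_of_mul_nonneg_right this hC0
  nlinarith [mul_nonneg ha (neg_nonneg.2 k1), mul_nonneg hb.le (neg_nonneg.2 k2), mul_nonneg hw.le (neg_nonneg.2 k3)]

end
end BP


namespace BP
noncomputable section
set_option linter.all false

open Real
variable {cs : CoxeterSystem M W}

lemma S_sym {m : ℕ} (h2 : 2 ≤ m) {k : ℕ} (hk : k ≤ m) :
    ch (cos (π / (m:ℝ))) (m - k) = ch (cos (π / (m:ℝ))) k := by
  obtain ⟨h3, h4, h5⟩ := th_facts h2
  have hs := sin_pos_of_pos_of_lt_pi h3 h4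
  apply mul_right_cancel₀ hs.ne'
  rw [ch_sin, ch_sin, Nat.cast_sub hk, sub_mul, h5, sin_pi_sub]

lemma S_ge {m : ℕ} (h2 : 2 ≤ m) {j k : ℕ} (hk : j ≤ k) (hk2 : k + j ≤ m) :
    ch (cos (π / (m:ℝ))) j ≤ ch (cos (π / (m:ℝ))) k := by
  obtain ⟨h3, h4, h5⟩ := th_facts h2
  have hs := sin_pos_of_pos_of_lt_pi h3 h4
  apply le_of_mul_le_mul_right _ hs
  rw [ch_sin, ch_sin, ← sub_nonneg, sin_sub_sin]
  set b := π / (m:ℝ)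
  have hk' : (j:ℝ) ≤ k := by exact_mod_cast hk
  have hk2' : (k:ℝ) + j ≤ m := by exact_mod_cast hk2
  have hj : (0:ℝ) ≤ j := by positivity
  have u1 : ((k:ℝ) + j) * b ≤ π := by rw [← h5]; gcongr
  have u2 : 0 ≤ ((k:ℝ) - j) * b := mul_nonneg (by linarith) h3.le
  have u3 : 0 ≤ ((k:ℝ) + j) * b := mul_nonneg (by linarith) h3.le
  have u4 : 0 ≤ (j:ℝ) * b := mul_nonneg hj h3.le
  have a1 : 0 ≤ sin ((k * b - j * b) / 2) := by
    apply sin_nonneg_of_nonneg_of_le_pi <;> nlinarith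
  have a2 : 0 ≤ cos ((k * b + j * b) / 2) := by
    apply cos_nonneg_of_neg_pi_div_two_le_of_le <;> nlinarith [pi_pos]
  positivity

lemma ch2 (C : ℝ) : ch C 2 = 2 * C := by simp [ch]
lemma ch1 (C : ℝ) : ch C 1 = 1 := by simp [ch]
lemma ch3 (C : ℝ) : ch C 3 = 4 * C ^ 2 - 1 := by simp [ch]; ring

variable {s t : B} {h x1 : W} {ζ η : B →₀ ℝ}

/-- goal -/
def Good (cs : CoxeterSystem M W) (s t : B) (h : W) (k : ℕ) : Prop :=
  ∃ δ, Root cs δ ∧ Pos δ ∧ Pos (-(rep cs h δ)) ∧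
    ch (cos (π / (M s t : ℝ))) k * bf M δ (al s) + ch (cos (π / (M s t : ℝ))) (k+1) * bf M δ (al t) ≤ -1

lemma eta_coef (H : Ctx cs s t h x1 ζ) (hη : Pos η) (hn : Pos (-(rep cs h η)))
    {a b w : ℝ} (e : η = a • al s + b • al t + w • ζ) : 0 < w := by
  have hw := H.coef_nonneg (by rw [← e]; exact hη)
  refine lt_of_le_of_ne hw ?_
  rintro rfl
  rw [zero_smul, add_zero] at e
  rw [e] at hη hn
  exact (plane_pos H.hst H.hα H.hβ hη).not_neg hn

lemma real_aux {a b w C e : ℝ} (hw : 0 < w) (hd : 0 < 1 - C^2 - e^2)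
    (nη : (a - C * b)^2 + (w - e * b)^2 + (1 - C^2 - e^2) * b^2 = 1)
    (h : a - C * b ≤ -1 ∨ b - C * a - e * w ≤ -1) : False := by
  rcases h with hb | hb
  · have h1 : 1 ≤ (a - C*b)^2 := by nlinarith
    have hb0 : b = 0 := by
      by_contra hb0
      have : 0 < b^2 := by positivity
      have h2 := mul_pos hd this
      have h3 := sq_nonneg (w - e * b)
      linarith
    subst hb0
    have : 0 < w^2 := by positivity
    have h4 : (w - e * 0)^2 = w^2 := by ring
    have h5 : (1 - C^2 - e^2) * (0:ℝ)^2 = 0 := by ring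
    linarith
  · have e1 : (b - C*a - e*w)^2 + ((1-C^2)*a^2 + (1-e^2)*w^2 - 2*C*e*a*w) = 1 := by linear_combination nη
    obtain ⟨x, hx⟩ : ∃ x, x = b - C*a - e*w := ⟨_, rfl⟩
    rw [← hx] at hb e1
    have e2 : 1 ≤ x^2 := by nlinarith
    have e3 : ((1-C^2)*a - C*e*w)^2 + (1-C^2-e^2)*w^2 = (1-C^2) * ((1-C^2)*a^2 + (1-e^2)*w^2 - 2*C*e*a*w) := by ring
    have e4 : 0 < (1-C^2-e^2)*w^2 := by positivity
    have e5 : 0 < (1-C^2) := by linarith [sq_nonneg e]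
    have e6 : (1-C^2) * ((1-C^2)*a^2 + (1-e^2)*w^2 - 2*C*e*a*w) ≤ 0 := mul_nonpos_of_nonneg_of_nonpos e5.le (by linarith)
    linarith [sq_nonneg ((1-C^2)*a - C*e*w)]

set_option maxHeartbeats 4000000 in
lemma core1 (H : Ctx cs s t h x1 ζ) {m : ℕ} (hm : M s t = m) (hm3 : 3 ≤ m)
    (hηS : InS s t ζ η) (hη : Root cs η) (hηp : Pos η) (hηn : Pos (-(rep cs h η)))
    (hηb : bf M η (al s) ≤ -1 ∨ bf M η (al t) ≤ -1)
    (h0 : bf M ζ (al s) = 0) {k : ℕ} (hk1 : 1 ≤ k) (hk2 : k + 2 ≤ m) : Good cs s t h k := by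
  unfold Good
  rw [hm]
  obtain ⟨e, he⟩ : ∃ e, bf M ζ (al t) = -e := ⟨- bf M ζ (al t), by ring⟩
  obtain ⟨b3, b4, b5⟩ := th_facts (show 2 ≤ m by omega)
  have hs := sin_pos_of_pos_of_lt_pi b3 b4
  have hbm : ((m:ℝ))*(π / m) = π := b5
  have hm3' : (3:ℝ) ≤ m := by exact_mod_cast hm3
  obtain ⟨C, hCdef⟩ : ∃ C, cos (π / (m:ℝ)) = C := ⟨_, rfl⟩
  have S1 : ∀ {k}, 1 ≤ k → k + 1 ≤ m → 1 ≤ ch C k := fun {k} h1 h2 => by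
    have := S_ge (show 2 ≤ m by omega) h1 h2
    rwa [hCdef, ch1] at this
  have S2 : ∀ {k}, 2 ≤ k → k + 2 ≤ m → 2 * C ≤ ch C k := fun {k} h1 h2 => by
    have := S_ge (show 2 ≤ m by omega) h1 h2
    rwa [hCdef, ch2] at this
  have S3 : ∀ {k}, 3 ≤ k → k + 3 ≤ m → 4 * C^2-1 ≤ ch C k := fun {k} h1 h2 => by
    have := S_ge (show 2 ≤ m by omega) h1 h2
    rwa [hCdef, ch3] at this
  have hC0 : 0 < C := by
    rw [← hCdef]
    apply cos_pos_of_mem_Ioo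
    constructor
    · linarith [pi_pos]
    · rw [div_lt_div_iff_of_pos_left pi_pos (by linarith) (by norm_num)]; linarith
  have hsC : sin (π / (m:ℝ)) ^ 2 = 1 - C ^ 2 := by rw [sin_sq, hCdef]
  set σ := sin (π / (m:ℝ)) with hσ
  have hC1 : C < 1 := by clear * - hs hsC; nlinarith
  rw [hCdef]
  have hC : bf M (al s) (al t) = -C := by rw [bf_al, hm, hCdef]
  have hC' : bf M (al t) (al s) = -C := by rw [bf_symm, hC]
  have h0' : bf M (al s) ζ = 0 := by rw [bf_symm, h0]
  have he' : bf M (al t) ζ = -e := by rw [bf_symm, he]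
  have hnz := H.root.norm
  have he_nn : 0 ≤ e := by have := H.swap.e_nonneg; rw [he] at this; linarith
  obtain ⟨a, b, w, eη⟩ := id hηS
  have hw : 0 < w := eta_coef H hηp hηn eη
  have ip1 : bf M η (al s) = a - C * b := by
    rw [eη]
    simp only [map_add, map_smul, LinearMap.add_apply, LinearMap.smul_apply, smul_eq_mul, bf_al_self,
      hC, hC', h0, h0', he, he', hnz]; ring
  have ip2 : bf M η (al t) = b - C * a - e * w := by
    rw [eη]
    simp only [map_add, map_smul, LinearMap.add_apply, LinearMap.smul_apply, smul_eq_mul, bf_al_self,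
      hC, hC', h0, h0', he, he', hnz]; ring
  have nη : (a - C * b)^2 + (w - e * b)^2 + (1 - C^2 - e^2) * b^2 = 1 := by
    have := hη.norm
    rw [eη] at this
    simp only [map_add, map_smul, LinearMap.add_apply, LinearMap.smul_apply, smul_eq_mul, bf_al_self,
      hC, hC', h0, h0', he, he', hnz] at this
    linarith
  -- zeta works
  have zw : 1 ≤ e * ch C (k+1) → ∃ δ, Root cs δ ∧ Pos δ ∧ Pos (-(rep cs h δ)) ∧
    ch C k * bf M δ (al s) + ch C (k+1) * bf M δ (al t) ≤ -1 := fun hh =>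
      ⟨ζ, H.root, H.pos, H.hneg, by rw [h0, he]; linarith⟩
  have hk1' : 1 ≤ ch C (k+1) := S1 (by omega) (by omega)
  by_cases hge : 1 ≤ e
  · exact zw (one_le_mul_of_one_le_of_one_le hge hk1')
  push Not at hge
  by_cases hlt : e < σ
  · exfalso
    have hd : 0 < 1 - C^2 - e^2 := by clear * - hs hsC he_nn hlt; nlinarith
    rw [ip1, ip2] at hηb
    exact real_aux hw hd nη hηb
  push Not at hlt
  have he0 : 0 < e := lt_of_lt_of_le hs hlt
  have hCe : 1 - C^2 ≤ e^2 := by clear * - hs hsC hlt; nlinarith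
  obtain ⟨z, hz⟩ := H.root.exists_ref
  have hzz : ∀ v, rep cs z (rep cs z v) = v := fun v => by
    rw [← rep_mul, hz.1.mul_self, rep_one]
  have htt : ∀ i v, rep cs (cs.simple i) (rep cs (cs.simple i) v) = v := fun i v => by
    rw [← rep_mul, cs.simple_mul_simple_self, rep_one]
  have hD := fun x h1 h2 h3 {ρ} => H.lemD hC hC0 h0 he he0 hge x h1 h2 h3 (ρ := ρ)
  have zα : rep cs z (al s) = al s := by rw [hz.2.2, h0]; simp
  have zβ : rep cs z (al t) = al t + (2*e) • ζ := by rw [hz.2.2, he]; module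
  have zζ := hz.self
  have hηζ : η ≠ ζ := by
    rintro rfl
    rcases hηb with hb | hb <;> linarith
  have zη := H.perm_z hz hηS hη hηp hηζ
  have zηS : InS s t ζ (rep cs z η) := hηS.refl_z hz
  have hV2 : Pos (-(rep cs h (rep cs z (al t)))) := by
    rw [← (((root_al t).rep z).rep h).not_pos]
    intro hp
    have := hD (h * z) (by rw [rep_mul, zα]; exact H.hα) (by rw [rep_mul]; exact hp)
      (by rw [rep_mul, zζ, map_neg]; exact H.hneg) zηS (hη.rep z) zη
    rw [rep_mul, hzz] at this
    exact this.not_neg hηn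
  have rV2 : Root cs (rep cs z (al t)) := (root_al t).rep z
  have V2s : bf M (rep cs z (al t)) (al s) = -C := by
    rw [zβ]
    simp only [map_add, map_smul, LinearMap.add_apply, LinearMap.smul_apply, smul_eq_mul, hC', h0]; ring
  have V2t : bf M (rep cs z (al t)) (al t) = 1 - 2 * e^2 := by
    rw [zβ]
    simp only [map_add, map_smul, LinearMap.add_apply, LinearMap.smul_apply, smul_eq_mul, bf_al_self, he]; ring
  by_cases hkm : k + 2 = m
  · refine ⟨rep cs z (al t), rV2,
      H.perm_z hz inS_t (root_al t) (pos_al t) H.ne_t, hV2, ?_⟩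
    have s1 : ch C (k+1) = 1 := by
      have := S_sym (m := m) (by omega) (k := 1) (by omega)
      rw [hCdef, ch1, show m - 1 = k + 1 by omega] at this
      exact this
    have s2 : ch C k = 2 * C := by
      have := S_sym (m := m) (by omega) (k := 2) (by omega)
      rw [hCdef, ch2, show m - 2 = k by omega] at this
      exact this
    rw [V2s, V2t, s1, s2]
    clear * - hCe; nlinarith
  have hm4 : 4 ≤ m := by omega
  have hm4' : (4:ℝ) ≤ m := by exact_mod_cast hm4
  have hhalf := H.swap.e_half he he0
  rcases lt_or_eq_of_le hhalf with hgt | heq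
  · have hsq := H.swap.e_sqrt he hgt
    apply zw
    have := S2 (k := k+1) (by omega) (by omega)
    have hC2 : 2 ≤ 4 * C^2 := by
      have : cos (π/4) ≤ C := by
        rw [← hCdef]
        apply cos_le_cos_of_nonneg_of_le_pi b3.le (by linarith [pi_pos])
        gcongr
      rw [cos_pi_div_four] at this
      have h2 : (√2)^2 = 2 := by norm_num
      have h3 : 0 < √2 := by positivity
      clear * - this h2 h3; nlinarith
    have h3 : 1 ≤ e * (2 * C) := by
      have : 1 ≤ (e * (2*C))^2 := by clear * - hsq hC2; nlinarith [mul_nonneg (sub_nonneg.2 hsq) (sub_nonneg.2 hC2)]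
      clear * - this he0 hC0; nlinarith [mul_pos he0 hC0]
    clear * - this h3 he0; nlinarith
  -- e = 1/2
  subst heq
  have hC34 : 3 / 4 ≤ C^2 := by linarith
  have hm6 : 6 ≤ m := by
    by_contra hcon
    have h5 : (m:ℝ) ≤ 5 := by
      have : m ≤ 5 := by omega
      exact_mod_cast this
    have h1 : π / 6 < π / m := by
      rw [div_lt_div_iff_of_pos_left pi_pos (by norm_num) (by linarith)]; linarith
    have : sin (π/6) < sin (π / m) := by
      apply sin_lt_sin_of_lt_of_le_pi_div_two (by linarith [pi_pos]) _ h1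
      rw [div_le_div_iff_of_pos_left pi_pos (by linarith) (by norm_num)]; linarith
    rw [sin_pi_div_six] at this
    linarith
  have tζ : rep cs (cs.simple t) ζ = ζ + al t := by rw [rep_simple, he']; module
  have tα : rep cs (cs.simple t) (al s) = al s + (2*C) • al t := by rw [rep_simple, hC']; module
  have ztζ : rep cs z (rep cs (cs.simple t) ζ) = al t := by
    rw [tζ, map_add, zζ, zβ]; module
  have hηV2 : η ≠ rep cs z (al t) := by
    rintro rfl
    rw [V2s, V2t] at hηb
    rcases hηb with hb | hb <;> linarith
  have tzη : Pos (rep cs (cs.simple t) (rep cs z η)) := by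
    apply perm_s (hη.rep z) zη
    intro hh; apply hηV2; rw [← hh, hzz]
  have hX : Pos (-(rep cs h (rep cs z (rep cs (cs.simple t) (al s))))) := by
    rw [← ((((root_al s).rep _).rep z).rep h).not_pos]
    intro hp
    have := hD (h * z * cs.simple t) (by rw [rep_mul, rep_mul]; exact hp)
      (by rw [rep_mul, rep_simple_self, map_neg, rep_mul]; exact hV2)
      (by rw [rep_mul, rep_mul, ztζ]; exact H.hβ) zηS.refl_t ((hη.rep z).rep _) tzη
    rw [rep_mul, htt, rep_mul, hzz] at this
    exact this.not_neg hηn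
  have rX : Root cs (rep cs z (rep cs (cs.simple t) (al s))) := ((root_al s).rep _).rep z
  have eX : rep cs z (rep cs (cs.simple t) (al s)) = al s + (2*C) • al t + (2*C) • ζ := by
    rw [tα, map_add, map_smul, zα, zβ]; module
  have Xs : bf M (rep cs z (rep cs (cs.simple t) (al s))) (al s) = 1 - 2 * C^2 := by
    rw [eX]
    simp only [map_add, map_smul, LinearMap.add_apply, LinearMap.smul_apply, smul_eq_mul, hC', h0, bf_al_self]; ring
  have Xt : bf M (rep cs z (rep cs (cs.simple t) (al s))) (al t) = 0 := by
    rw [eX]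
    simp only [map_add, map_smul, LinearMap.add_apply, LinearMap.smul_apply, smul_eq_mul, hC, he, bf_al_self]; ring
  by_cases hk3 : k + 3 = m
  · refine ⟨_, rX, H.pos_of_coef rX (x := 1) (by rw [eX, one_smul]) (by linarith), hX, ?_⟩
    have s2 : ch C k = 4 * C^2 - 1 := by
      have := S_sym (m := m) (by omega) (k := 3) (by omega)
      rw [hCdef, ch3, show m - 3 = k by omega] at this
      exact this
    rw [Xs, Xt, s2]
    clear * - hC34; nlinarith
  by_cases hk2' : 2 ≤ k
  · apply zw
    have := S3 (k := k+1) (by omega) (by omega)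
    linarith
  obtain rfl : k = 1 := by omega
  rw [ch1, one_add_one_eq_two, ch2]
  by_cases hηs : bf M η (al s) ≤ -1
  · by_cases hηt : bf M η (al t) ≤ 0
    · exact ⟨η, hη, hηp, hηn, by clear * - hηs hηt hC0; nlinarith⟩
    · push Not at hηt
      have hηt' : bf M (al t) η = bf M η (al t) := bf_symm _ _
      refine ⟨rep cs (cs.simple t) η, hη.rep _, perm_s hη hηp ?_, ?_, ?_⟩
      · rintro rfl; exact H.hβ.not_neg hηn
      · rw [rep_simple, map_sub, map_smul, hηt']
        convert hηn.add (H.hβ.smul (a := 2 * bf M η (al t)) (by linarith)).2 using 1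
        module
      · rw [rep_simple]
        simp only [map_sub, map_smul, LinearMap.sub_apply, LinearMap.smul_apply, smul_eq_mul, hC', bf_al_self, hηt']
        linarith
  have hηt : bf M η (al t) ≤ -1 := hηb.resolve_left hηs
  by_cases hm7 : 7 ≤ m
  · have hm7' : (7:ℝ) ≤ m := by exact_mod_cast hm7
    have hC9 : 0.89 ≤ C := by
      have h1 := one_sub_sq_div_two_le_cos (x := π / m)
      rw [hCdef] at h1
      have h2 : π / m ≤ 0.46 := by
        rw [div_le_iff₀ (by linarith)]
        clear * - hm7'; nlinarith [pi_lt_d2]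
      clear * - h1 h2 b3; nlinarith
    have hηX : η ≠ rep cs z (rep cs (cs.simple t) (al s)) := by
      intro hh
      rw [hh, Xt] at hηt
      linarith
    have stzη : Pos (rep cs (cs.simple s) (rep cs (cs.simple t) (rep cs z η))) := by
      apply perm_s ((hη.rep z).rep _) tzη
      intro hh; apply hηX; rw [← hh, htt, hzz]
    have sβ : rep cs (cs.simple s) (al t) = al t + (2*C) • al s := by rw [rep_simple, hC]; module
    have eY : rep cs z (rep cs (cs.simple t) (rep cs (cs.simple s) (al t))) =
        (2*C) • al s + (4*C^2-1) • al t + (4*C^2-1) • ζ := by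
      rw [sβ, map_add, map_smul, tα, rep_simple_self, map_add, map_neg, map_smul, map_add, map_smul, zα, zβ]
      module
    have rY : Root cs (rep cs z (rep cs (cs.simple t) (rep cs (cs.simple s) (al t)))) :=
      (((root_al t).rep _).rep _).rep _
    have sζ : rep cs (cs.simple s) ζ = ζ := by rw [rep_simple, h0']; simp
    refine ⟨_, rY, H.pos_of_coef rY eY (by clear * - hC9; nlinarith), ?_, ?_⟩
    · rw [← (rY.rep h).not_pos]
      intro hp
      have := hD (h * z * cs.simple t * cs.simple s)
        (by rw [rep_mul, rep_simple_self, map_neg, rep_mul, rep_mul]; exact hX)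
        (by rw [rep_mul, rep_mul, rep_mul]; exact hp)
        (by rw [rep_mul, sζ, rep_mul, rep_mul, ztζ]; exact H.hβ)
        (zηS.refl_t.refl_s) (((hη.rep z).rep _).rep _) stzη
      rw [rep_mul, htt, rep_mul, htt, rep_mul, hzz] at this
      exact this.not_neg hηn
    · rw [eY]
      simp only [map_add, map_smul, LinearMap.add_apply, LinearMap.smul_apply, smul_eq_mul, hC, hC', h0, he, bf_al_self]
      have : 0 ≤ (C - 0.89) * C^2 := mul_nonneg (by linarith) (by positivity)
      clear * - this hC9; nlinarith
  · have hm6' : m = 6 := by omega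
    have hC6 : C^2 = 3/4 := by
      rw [← hCdef, hm6']
      push_cast
      rw [cos_pi_div_six, div_pow]; norm_num
    rw [ip2] at hηt
    obtain ⟨p, hp⟩ : ∃ p, p = a - C * b := ⟨_, rfl⟩
    obtain ⟨q, hq⟩ : ∃ q, q = w - 1/2 * b := ⟨_, rfl⟩
    have n1 : p^2 + q^2 = 1 := by
      rw [hp, hq]
      have : (1 - C^2 - (1/2)^2) * b^2 = 0 := by rw [hC6]; norm_num
      linarith
    have n2 : b - C * a - 1/2 * w = - C * p - 1/2 * q := by
      rw [hp, hq]
      have : C^2 * b = 3/4 * b := by rw [hC6]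
      linarith
    have n3 : (p - C)^2 + (q - 1/2)^2 ≤ 0 := by rw [n2] at hηt; clear * - hηt n1 hC6; nlinarith
    have hpC : p = C := by clear * - n3; nlinarith [sq_nonneg (p - C), sq_nonneg (q - 1/2)]
    have hqh : q = 1/2 := by clear * - n3; nlinarith [sq_nonneg (p - C), sq_nonneg (q - 1/2)]
    have i1 : bf M η (al s) = C := by rw [ip1, ← hp, hpC]
    have i2 : bf M η (al t) = -1 := by rw [ip2, n2, hpC, hqh]; clear * - hC6; nlinarith
    obtain ⟨y, hy⟩ := hη.exists_ref
    have eK : -(rep cs y (al s)) = - al s + (2 * C) • η := by rw [hy.2.2, i1]; module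
    have rK : Root cs (-(rep cs y (al s))) := ((root_al s).rep _).neg
    refine ⟨_, rK, H.pos_of_coef rK (x := -1 + 2*C*a) (y := 2*C*b) (w := 2*C*w) ?_ (by positivity), ?_, ?_⟩
    · rw [eK, eη]; module
    · rw [eK, map_add, map_neg, map_smul]
      convert H.hα.add (hηn.smul (a := 2*C) (by linarith)).2 using 1
      module
    · rw [eK]
      simp only [map_add, map_neg, map_smul, LinearMap.add_apply, LinearMap.neg_apply, LinearMap.smul_apply, smul_eq_mul, hC, i1, i2, bf_al_self]
      clear * - hC6 hC0; nlinarith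

end
end BP


namespace BP
noncomputable section
set_option linter.all false

open Real
variable {cs : CoxeterSystem M W}
variable {s t : B} {h x1 : W} {ζ η : B →₀ ℝ}

lemma core2 (H : Ctx cs s t h x1 ζ) {m : ℕ} (hm : M s t = m) (hm3 : 3 ≤ m)
    (hηS : InS s t ζ η) (hη : Root cs η) (hηp : Pos η) (hηn : Pos (-(rep cs h η)))
    (hηb : bf M η (al s) ≤ -1 ∨ bf M η (al t) ≤ -1)
    {k : ℕ} (hk1 : 1 ≤ k) (hk2 : k + 2 ≤ m) : Good cs s t h k := by
  by_cases h0 : bf M ζ (al s) = 0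
  · exact core1 H hm hm3 hηS hη hηp hηn hηb h0 hk1 hk2
  by_cases h0' : bf M ζ (al t) = 0
  · have hm' : M t s = m := by rw [M.symmetric, hm]
    obtain ⟨a, b, w, e⟩ := id hηS
    have hS : InS t s ζ η := ⟨b, a, w, by rw [e]; module⟩
    obtain ⟨δ, d1, d2, d3, d4⟩ := core1 H.swap hm' hm3 hS hη hηp hηn hηb.symm h0' (k := m - 1 - k) (by omega) (by omega)
    refine ⟨δ, d1, d2, d3, ?_⟩
    rw [hm'] at d4
    rw [hm]
    have s1 := S_sym (m := m) (by omega) (k := k+1) (by omega)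
    have s2 := S_sym (m := m) (by omega) (k := k) (by omega)
    rw [show m - (k+1) = m - 1 - k by omega] at s1
    rw [show m - k = m - 1 - k + 1 by omega] at s2
    rw [s1, s2] at d4
    linarith
  · have e1 := lt_of_le_of_ne H.e_nonneg h0
    have e2 := lt_of_le_of_ne H.swap.e_nonneg h0'
    have f1 := H.e_half (e := - bf M ζ (al s)) (by ring) (by linarith)
    have f2 := H.swap.e_half (e := - bf M ζ (al t)) (by ring) (by linarith)
    refine ⟨ζ, H.root, H.pos, H.hneg, ?_⟩
    rw [hm]
    have S1 := S_ge (m := m) (by omega) (j := 1) (k := k) hk1 (by omega)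
    have S2 := S_ge (m := m) (by omega) (j := 1) (k := k+1) (by omega) (by omega)
    rw [ch1] at S1 S2
    nlinarith

lemma core3 (hst : s ≠ t) (hα : Pos (rep cs h (al s))) (hβ : Pos (rep cs h (al t)))
    {m : ℕ} (hm : M s t = m) (hm3 : 3 ≤ m)
    (hη : Root cs η) (hηp : Pos η) (hηn : Pos (-(rep cs h η)))
    (hηb : bf M η (al s) ≤ -1 ∨ bf M η (al t) ≤ -1)
    {k : ℕ} (hk1 : 1 ≤ k) (hk2 : k + 2 ≤ m) : Good cs s t h k := by
  obtain ⟨x1, ζ, z1, z2, z3, z4, z5, z6⟩ := choose_zeta (cs := cs) {v | InS s t η v} _ h η rfl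
    ⟨0, 0, 1, by module⟩ hη hηp hηn
  obtain ⟨x, y, z, e⟩ := id z1
  have hz : z ≠ 0 := by
    rintro rfl
    rw [zero_smul, add_zero] at e
    rw [e] at z3 z4
    exact (plane_pos hst hα hβ z3).not_neg z4
  have hsub : ∀ v, InS s t ζ v → InS s t η v := by
    rintro v ⟨a, b, c, rfl⟩
    exact ⟨a + c * x, b + c * y, c * z, by rw [e]; module⟩
  have hS : InS s t ζ η := by
    refine ⟨-(z⁻¹ * x), -(z⁻¹ * y), z⁻¹, ?_⟩
    rw [e, smul_add, smul_add, smul_smul, smul_smul, smul_smul, inv_mul_cancel₀ hz]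
    module
  have H : Ctx cs s t h x1 ζ :=
    { hst := hst, root := z2, pos := z3, hneg := z4, hα := hα, hβ := hβ, x1neg := z5,
      uniq := fun ρ h1 h2 h3 h4 => z6 ρ (hsub _ h1) h2 h3 h4 }
  exact core2 H hm hm3 hS hη hηp hηn hηb hk1 hk2

end
end BP


namespace BP
noncomputable section
set_option linter.all false

open Real
variable {cs : CoxeterSystem M W}
variable {s t : B} {h : W} {η γ : B →₀ ℝ}

lemma closure_stab (Z : (B →₀ ℝ) → Prop)
    (hs : ∀ v, Z v → Z (rep cs (cs.simple s) v)) (ht : ∀ v, Z v → Z (rep cs (cs.simple t) v))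
    {x : W} (hx : x ∈ Subgroup.closure ({cs.simple s, cs.simple t} : Set W)) :
    ∀ v, Z v ↔ Z (rep cs x v) := by
  have htt : ∀ i v, rep cs (cs.simple i) (rep cs (cs.simple i) v) = v := fun i v => by
    rw [← rep_mul, cs.simple_mul_simple_self, rep_one]
  induction hx using Subgroup.closure_induction with
  | mem x hx =>
    intro v
    rcases hx with rfl | rfl
    · exact ⟨hs v, fun h => by have := hs _ h; rwa [htt] at this⟩
    · exact ⟨ht v, fun h => by have := ht _ h; rwa [htt] at this⟩
  | one => intro v; rw [rep_one]
  | mul x y _ _ hx hy => intro v; rw [rep_mul, ← hx, ← hy]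
  | inv x _ hx => intro v; rw [hx (rep cs x⁻¹ v), rep_self_inv]

lemma SepR.neg {δ} (hh : SepR cs h δ γ) : SepR cs h δ (-γ) := by
  rintro f ⟨i, hf⟩
  apply hh f
  refine ⟨i, ?_⟩
  rw [map_neg, neg_eq_iff_eq_neg, neg_inj] at hf
  exact hf.symm

lemma inf_case (hst : s ≠ t) (hα : Pos (rep cs h (al s))) (hβ : Pos (rep cs h (al t)))
    (hm : M s t = 0) (hγ : Root cs γ) (hS : InS s t 0 γ)
    (h1 : γ ≠ al s) (h2 : γ ≠ - al s) (h3 : γ ≠ al t) (h4 : γ ≠ - al t) :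
    ∃ δ, Root cs δ ∧ SepR cs h δ γ := by
  wlog hp : Pos γ generalizing γ
  · obtain ⟨x, y, w, e⟩ := hS
    obtain ⟨δ, d1, d2⟩ := this hγ.neg ⟨-x, -y, w, by rw [e]; simp; module⟩
      (fun h => h2 (by rw [← h, neg_neg])) (fun h => h1 (neg_inj.1 h))
      (fun h => h4 (by rw [← h, neg_neg])) (fun h => h3 (neg_inj.1 h)) (hγ.not_pos.1 hp)
    exact ⟨δ, d1, by simpa using d2.neg⟩
  obtain ⟨x, y, w, e⟩ := id hS
  have hC : bf M (al s) (al t) = -1 := by rw [bf_al, hm]; simp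
  have hC' : bf M (al t) (al s) = -1 := by rw [bf_symm, hC]
  rw [smul_zero, add_zero] at e
  have n := hγ.norm
  rw [e] at n
  simp only [map_add, map_smul, LinearMap.add_apply, LinearMap.smul_apply, smul_eq_mul, bf_al_self, hC, hC'] at n
  have n' : (x - y - 1) * (x - y + 1) = 0 := by linarith
  rcases mul_eq_zero.1 n' with n' | n'
  · refine ⟨- al s, (root_al s).neg, sepR_of (root_al s).neg hγ ?_ (cs.simple s) ?_ (perm_s hγ hp h1) ?_⟩
    · rw [e]
      simp only [map_add, map_neg, map_smul, LinearMap.neg_apply, smul_eq_mul, bf_al_self, hC, hC']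
      linarith
    · rw [map_neg, rep_simple_self, neg_neg]; exact pos_al s
    · rwa [map_neg, neg_neg]
  · refine ⟨- al t, (root_al t).neg, sepR_of (root_al t).neg hγ ?_ (cs.simple t) ?_ (perm_s hγ hp h3) ?_⟩
    · rw [e]
      simp only [map_add, map_neg, map_smul, LinearMap.neg_apply, smul_eq_mul, bf_al_self, hC, hC']
      linarith
    · rw [map_neg, rep_simple_self, neg_neg]; exact pos_al t
    · rwa [map_neg, neg_neg]

/-- the dihedral vectors -/
def Dih (s t : B) (b : ℝ) (v : B →₀ ℝ) : Prop :=
  ∃ k : ℤ, sin b • v = sin (k * b) • al s + sin (k * b + b) • al t ∨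
    sin b • v = -(sin (k * b) • al s + sin (k * b + b) • al t)

lemma dih_s {b : ℝ} (hb : bf M (al s) (al t) = - cos b) (v) (hv : Dih s t b v) :
    Dih s t b (rep cs (cs.simple s) v) := by
  obtain ⟨k, hk⟩ := hv
  refine ⟨-k-2, ?_⟩
  have e := sg_gam (M := M) s t (k * b) b hb
  rw [← map_smul, rep_simple, ← sg_apply]
  have e1 : (((-k-2 : ℤ)):ℝ) * b = -(k*b) - 2*b := by push_cast; ring
  have e2 : -(k*b) - 2*b + b = -(k*b) - b := by ring
  rw [e1, e2]
  rcases hk with hk | hk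
  · right; rw [hk, e]
  · left; rw [hk, map_neg, e, neg_neg]

lemma dih_t {b : ℝ} (hb : bf M (al s) (al t) = - cos b) (v) (hv : Dih s t b v) :
    Dih s t b (rep cs (cs.simple t) v) := by
  obtain ⟨k, hk⟩ := hv
  refine ⟨-k, ?_⟩
  have e := sg_gam' (M := M) s t (k * b) b hb
  rw [← map_smul, rep_simple, ← sg_apply]
  have e1 : (((-k : ℤ)):ℝ) * b = -(k*b) := by push_cast; ring
  rw [e1]
  rcases hk with hk | hk
  · right; rw [hk, e]
  · left; rw [hk, map_neg, e, neg_neg]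

lemma dih_red {m : ℕ} (hm : 2 ≤ m) {v : B →₀ ℝ} (hv : Dih s t (π / (m:ℝ)) v) :
    ∃ k : ℕ, k < m ∧
      (v = ch (cos (π / (m:ℝ))) k • al s + ch (cos (π / (m:ℝ))) (k+1) • al t ∨
      v = -(ch (cos (π / (m:ℝ))) k • al s + ch (cos (π / (m:ℝ))) (k+1) • al t)) := by
  obtain ⟨k, hk⟩ := hv
  obtain ⟨h3, h4, h5⟩ := th_facts hm
  have hs := (sin_pos_of_pos_of_lt_pi h3 h4).ne'
  have hm0 : (0:ℤ) < m := by omega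
  obtain ⟨j, hj⟩ : ∃ j : ℕ, (j:ℤ) = k % m := ⟨(k % m).toNat, Int.toNat_of_nonneg (Int.emod_nonneg _ hm0.ne')⟩
  obtain ⟨n, hn⟩ : ∃ n, n = k / m := ⟨_, rfl⟩
  have hkj : k = j + n * m := by rw [hj, hn, mul_comm]; exact (Int.emod_add_mul_ediv k m).symm
  have hjm : j < m := by
    have := Int.emod_lt_of_pos k hm0
    omega
  refine ⟨j, hjm, ?_⟩
  set b := π / (m:ℝ) with hb
  have e1 : (k:ℝ) * b = j * b + n * π := by rw [hkj, ← h5]; push_cast; ring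
  have e2 : (k:ℝ) * b + b = (j+1:ℕ) * b + n * π := by rw [e1]; push_cast; ring
  rw [e2, e1, sin_add_int_mul_pi, sin_add_int_mul_pi, ← ch_sin, ← ch_sin] at hk
  have key : sin b • v = sin b • (ch (cos b) j • al s + ch (cos b) (j + 1) • al t) ∨
    sin b • v = sin b • (-(ch (cos b) j • al s + ch (cos b) (j + 1) • al t)) := by
    rcases Int.even_or_odd n with hn | hn
    · rw [hn.neg_one_zpow] at hk
      rcases hk with hk | hk
      · left; rw [hk]; module
      · right; rw [hk]; module
    · rw [hn.neg_one_zpow] at hk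
      rcases hk with hk | hk
      · right; rw [hk]; module
      · left; rw [hk]; module
  rcases key with k1 | k1
  · exact Or.inl (smul_right_injective _ hs k1)
  · exact Or.inr (smul_right_injective _ hs k1)

lemma fin_case (hst : s ≠ t) (hα : Pos (rep cs h (al s))) (hβ : Pos (rep cs h (al t)))
    {m : ℕ} (hm : M s t = m) (hm3 : 3 ≤ m)
    (hη : Root cs η) (hηp : Pos η) (hηn : Pos (-(rep cs h η)))
    (hηb : bf M η (al s) ≤ -1 ∨ bf M η (al t) ≤ -1)
    (hγ : Root cs γ) (hS : Dih s t (π / (m:ℝ)) γ)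
    (h1 : γ ≠ al s) (h2 : γ ≠ - al s) (h3 : γ ≠ al t) (h4 : γ ≠ - al t) :
    ∃ δ, Root cs δ ∧ SepR cs h δ γ := by
  obtain ⟨k, hk, e⟩ := dih_red (by omega) hS
  have s0 := S_sym (m := m) (by omega) (k := 0) (by omega)
  have s1 := S_sym (m := m) (by omega) (k := 1) (by omega)
  rw [ch1] at s1
  have hc0 : ∀ C, ch C 0 = 0 := fun C => by simp [ch]
  rw [Nat.sub_zero, hc0] at s0
  have hk1 : 1 ≤ k := by
    by_contra hcon
    obtain rfl : k = 0 := by omega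
    rw [zero_add, ch1, hc0, zero_smul, one_smul, zero_add] at e
    tauto
  have hk2 : k + 2 ≤ m := by
    by_contra hcon
    obtain rfl : k = m - 1 := by omega
    rw [show m - 1 + 1 = m by omega, s1, s0, zero_smul, one_smul, add_zero] at e
    tauto
  obtain ⟨δ, d1, d2, d3, d4⟩ := core3 hst hα hβ hm hm3 hη hηp hηn hηb hk1 hk2
  rw [hm] at d4
  set v := ch (cos (π / (m:ℝ))) k • al s + ch (cos (π / (m:ℝ))) (k+1) • al t with hv
  have hvr : Root cs v := by
    rcases e with e | e
    · rwa [← e]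
    · rw [← neg_neg v, ← e]; exact hγ.neg
  have hvp : Pos v := by
    have p1 := ch_pos (M := M) hst k (by omega) (fun _ => by omega)
    have p2 := ch_pos (M := M) hst (k+1) (by omega) (fun _ => by omega)
    rw [hm] at p1 p2
    exact (pos_al s).comb (pos_al t) p1.le p2.le (Or.inl p1)
  have hsep : SepR cs h δ v := by
    apply sepR_of d1 hvr ?_ 1 (by rwa [rep_one]) (by rwa [rep_one]) d3
    rw [hv]
    simp only [map_add, map_smul, smul_eq_mul]
    exact d4
  refine ⟨δ, d1, ?_⟩
  rcases e with e | e
  · rwa [e]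
  · rw [e]; exact hsep.neg

lemma main_aux (hst : s ≠ t) (hnc : cs.simple s * cs.simple t ≠ cs.simple t * cs.simple s)
    (hα : Pos (rep cs h (al s))) (hβ : Pos (rep cs h (al t)))
    (hη : Root cs η) (hηp : Pos η) (hηn : Pos (-(rep cs h η)))
    (hηb : bf M η (al s) ≤ -1 ∨ bf M η (al t) ≤ -1)
    {x : W} (hx : x ∈ Subgroup.closure ({cs.simple s, cs.simple t} : Set W))
    (hγ : γ = rep cs x (al s) ∨ γ = rep cs x (al t))
    (h1 : γ ≠ al s) (h2 : γ ≠ - al s) (h3 : γ ≠ al t) (h4 : γ ≠ - al t) :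
    ∃ δ, Root cs δ ∧ SepR cs h δ γ := by
  have hγr : Root cs γ := by
    rcases hγ with rfl | rfl
    · exact (root_al s).rep x
    · exact (root_al t).rep x
  by_cases hm0 : M s t = 0
  · refine inf_case hst hα hβ hm0 hγr ?_ h1 h2 h3 h4
    have := closure_stab (fun v => InS s t 0 v) (fun v hv => hv.refl_s) (fun v hv => hv.refl_t) hx
    rcases hγ with rfl | rfl
    · exact (this _).1 inS_s
    · exact (this _).1 inS_t
  · have hm1 : M s t ≠ 1 := M.off_diagonal s t hst
    have hm2 : M s t ≠ 2 := by
      intro h2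
      have := cs.simple_mul_simple_pow s t
      rw [h2, sq] at this
      apply hnc
      have h5 := mul_eq_one_iff_eq_inv.1 this
      simpa using h5
    obtain ⟨m, hm⟩ : ∃ m, M s t = m := ⟨_, rfl⟩
    have hm3 : 3 ≤ m := by omega
    have hb : bf M (al s) (al t) = - cos (π / (m:ℝ)) := by rw [bf_al, hm]
    refine fin_case hst hα hβ hm hm3 hη hηp hηn hηb hγr ?_ h1 h2 h3 h4
    have := closure_stab (cs := cs) (fun v => Dih s t (π / (m:ℝ)) v) (dih_s hb) (dih_t hb) hx
    rcases hγ with rfl | rfl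
    · refine (this _).1 ⟨-1, Or.inr ?_⟩
      simp
    · refine (this _).1 ⟨0, Or.inl ?_⟩
      simp

theorem main (cs : CoxeterSystem M W) (r q w g : W)
    (hcomm : r * q ≠ q * r)
    (s t : B) (hs : w⁻¹ * r * w = cs.simple s) (ht : w⁻¹ * q * w = cs.simple t)
    (hgs : cs.length (cs.simple s * (w⁻¹ * g)) > cs.length (w⁻¹ * g))
    (hgt : cs.length (cs.simple t * (w⁻¹ * g)) > cs.length (w⁻¹ * g))
    (u : W) (hu : cs.IsReflection u)
    (husep : SepFromWall cs u g r ∨ SepFromWall cs u g q) :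
    ∀ r' : W, (∃ v ∈ Subgroup.closure ({r, q} : Set W),
        r' = v * r * v⁻¹ ∨ r' = v * q * v⁻¹) →
      r' ∉ ({r, q} : Set W) →
      ∃ u' : W, cs.IsReflection u' ∧ SepFromWall cs u' g r' := by
  obtain rfl : r = w * cs.simple s * w⁻¹ := by rw [← hs]; group
  obtain rfl : q = w * cs.simple t * w⁻¹ := by rw [← ht]; group
  rintro r' ⟨v, hv, hr'⟩ hnot
  have hst : s ≠ t := by rintro rfl; exact hcomm rfl
  have hnc : cs.simple s * cs.simple t ≠ cs.simple t * cs.simple s := by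
    intro hh
    apply hcomm
    calc w * cs.simple s * w⁻¹ * (w * cs.simple t * w⁻¹) = w * (cs.simple s * cs.simple t) * w⁻¹ := by group
      _ = w * (cs.simple t * cs.simple s) * w⁻¹ := by rw [hh]
      _ = _ := by group
  have hpos : ∀ i, cs.length (cs.simple i * (w⁻¹ * g)) > cs.length (w⁻¹ * g) →
      Pos (rep cs (g⁻¹ * w) (al i)) := by
    intro i hi
    have h1 : ¬ cs.length (cs.simple i * (w⁻¹ * g)) < cs.length (w⁻¹ * g) := by omega
    rw [ref_lt_iff (refOf_simple i) (pos_al i), ((root_al i).rep _).not_neg] at h1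
    simpa using h1
  have hα := hpos s hgs
  have hβ := hpos t hgt
  have Rr : RefOf cs (w * cs.simple s * w⁻¹) (rep cs w (al s)) := (refOf_simple s).conj w
  have Rq : RefOf cs (w * cs.simple t * w⁻¹) (rep cs w (al t)) := (refOf_simple t).conj w
  obtain ⟨d, hd⟩ := exists_root hu
  have hd' : RefOf cs u (rep cs w (rep cs w⁻¹ d)) := by rwa [rep_self_inv]
  obtain ⟨η, hη, hηp, hηn, hηb⟩ : ∃ η, Root cs η ∧ Pos η ∧ Pos (-(rep cs (g⁻¹ * w) η)) ∧
      (bf M η (al s) ≤ -1 ∨ bf M η (al t) ≤ -1) := by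
    rcases husep with hh | hh
    · rw [sepFromWall_iff hd' Rr] at hh
      obtain ⟨η, a, b, c, d⟩ := sep_imp (hd.2.1.rep _) hα hh
      exact ⟨η, a, b, c, Or.inl d⟩
    · rw [sepFromWall_iff hd' Rq] at hh
      obtain ⟨η, a, b, c, d⟩ := sep_imp (hd.2.1.rep _) hβ hh
      exact ⟨η, a, b, c, Or.inr d⟩
  have hx : w⁻¹ * v * w ∈ Subgroup.closure ({cs.simple s, cs.simple t} : Set W) := by
    have key : ∀ v, v ∈ Subgroup.closure ({w * cs.simple s * w⁻¹, w * cs.simple t * w⁻¹} : Set W) →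
        w⁻¹ * v * w ∈ Subgroup.closure ({cs.simple s, cs.simple t} : Set W) := by
      intro v hv
      induction hv using Subgroup.closure_induction with
      | mem x hx =>
        rcases hx with rfl | rfl
        · rw [hs]; exact Subgroup.subset_closure (by simp)
        · rw [ht]; exact Subgroup.subset_closure (by simp)
      | one => simp
      | mul x y _ _ hx hy =>
        have := mul_mem hx hy
        rwa [show w⁻¹ * x * w * (w⁻¹ * y * w) = w⁻¹ * (x * y) * w by group] at this
      | inv x _ hx =>
        have := inv_mem hx
        rwa [show (w⁻¹ * x * w)⁻¹ = w⁻¹ * x⁻¹ * w by group] at this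
    exact key v hv
  obtain ⟨γ, hγ, Rγ⟩ : ∃ γ, (γ = rep cs (w⁻¹ * v * w) (al s) ∨ γ = rep cs (w⁻¹ * v * w) (al t)) ∧
      RefOf cs r' (rep cs w γ) := by
    have e : ∀ i, rep cs w (rep cs (w⁻¹ * v * w) (al i)) = rep cs v (rep cs w (al i)) := by
      intro i
      rw [← rep_mul, ← rep_mul]; congr 2; group
    rcases hr' with rfl | rfl
    · exact ⟨_, Or.inl rfl, by rw [e]; exact Rr.conj v⟩
    · exact ⟨_, Or.inr rfl, by rw [e]; exact Rq.conj v⟩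
  simp only [Set.mem_insert_iff, Set.mem_singleton_iff, not_or] at hnot
  obtain ⟨δ, d1, d2⟩ := main_aux hst hnc hα hβ hη hηp hηn hηb hx hγ
    (by rintro rfl; exact hnot.1 (Rγ.unique Rr))
    (by rintro rfl; rw [map_neg] at Rγ; exact hnot.1 (Rγ.unique Rr.neg))
    (by rintro rfl; exact hnot.2 (Rγ.unique Rq))
    (by rintro rfl; rw [map_neg] at Rγ; exact hnot.2 (Rγ.unique Rq.neg))
  obtain ⟨u', hu'⟩ := (d1.rep w).exists_ref
  exact ⟨u', hu'.1, (sepFromWall_iff hu' Rγ).2 d2⟩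

end
end BP

/-- Bipodality: let `r, q` be sharp-angled reflections (non-commuting, with
`w⁻¹rw = s ∈ S` and `w⁻¹qw = t ∈ S`), and let `g` lie in the geometric fundamental
domain for `⟨r,q⟩` containing `w`. If some reflection `u` separates `g` from the wall
of `r` or from the wall of `q`, then for every reflection `r' = vrv⁻¹` or `vqv⁻¹`
with `v ∈ ⟨r,q⟩` and `r' ∉ {r,q}`, some reflection `u'` separates `g` from the wall
of `r'`. -/
theorem bipodality [Finite B] (cs : CoxeterSystem M W) (r q w g : W)
    (hr : cs.IsReflection r) (hq : cs.IsReflection q)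
    (hcomm : r * q ≠ q * r)
    (s t : B) (hs : w⁻¹ * r * w = cs.simple s) (ht : w⁻¹ * q * w = cs.simple t)
    (hgs : cs.length (cs.simple s * (w⁻¹ * g)) > cs.length (w⁻¹ * g))
    (hgt : cs.length (cs.simple t * (w⁻¹ * g)) > cs.length (w⁻¹ * g))
    (u : W) (hu : cs.IsReflection u)
    (husep : SepFromWall cs u g r ∨ SepFromWall cs u g q) :
    ∀ r' : W, (∃ v ∈ Subgroup.closure ({r, q} : Set W),
        r' = v * r * v⁻¹ ∨ r' = v * q * v⁻¹) →
      r' ∉ ({r, q} : Set W) →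
      ∃ u' : W, cs.IsReflection u' ∧ SepFromWall cs u' g r' := by
  exact BP.main cs r q w g hcomm s t hs ht hgs hgt u hu husep
end
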